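/- Let n ≥ 2 be an integer and let f ∈ ℤ[X] be squarefree (in ℚ[X]) with deg f ≥ 3. Then (with no local solubility hypothesis on y^n = f(x) itself) there exist a real γ with 0 ≤ γ < 1, a constant c > 0 and X₀ such that for all real X ≥ X₀, the number of n-th power free integers d with |d| ≤ X for which the twist C_d : d·y^n = f(x) is everywhere locally soluble is at least c·X/(log X)^γ. -/

import Mathlib

open Polynomial

/-- The radical of an integer: the product of its distinct prime factors. -/
def IntRadical (m : ℤ) : ℕ := ∏ p ∈ m.natAbs.primeFactors, p

/-- The abc conjecture of Masser–Oesterlé. -/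
def ABCConjecture : Prop :=
  ∀ ε : ℝ, 0 < ε → ∃ K : ℝ, 0 < K ∧ ∀ a b c : ℤ,
    a ≠ 0 → b ≠ 0 → c ≠ 0 →
    IsCoprime a b → IsCoprime a c → IsCoprime b c →
    a + b = c →
    ((max (max |a| |b|) |c| : ℤ) : ℝ) ≤ K * (IntRadical (a * b * c) : ℝ) ^ (1 + ε)

/-- `d` is `n`-th power free. -/
def NthPowerFree (n : ℕ) (d : ℤ) : Prop :=
  d ≠ 0 ∧ ∀ p : ℕ, p.Prime → ¬ ((p : ℤ) ^ n ∣ d)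

/-- A `K`-point of the twist `C_d : d·y^n = f(x)`. -/
def HasTwistPoint (n : ℕ) (f : Polynomial ℤ) (d : ℤ) (K : Type) [CommRing K] : Prop :=
  ∃ x y : K, (d : K) * y ^ n = Polynomial.aeval x f

/-- The twist `C_d : d·y^n = f(x)` has points everywhere locally. -/
def EverywhereLocallySoluble (n : ℕ) (f : Polynomial ℤ) (d : ℤ) : Prop :=
  HasTwistPoint n f d ℝ ∧ ∀ (p : ℕ) (_ : Fact p.Prime), HasTwistPoint n f d ℚ_[p]

/-- The twist `C_d` violates the Hasse principle. -/
def ViolatesHasse (n : ℕ) (f : Polynomial ℤ) (d : ℤ) : Prop :=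
  EverywhereLocallySoluble n f d ∧ ¬ HasTwistPoint n f d ℚ

/-- `f` is weakly intersective: the primes modulo which `f` has a root have
relative natural density `1` in the primes. -/
def WeaklyIntersective (f : Polynomial ℤ) : Prop :=
  Filter.Tendsto (fun X : ℕ =>
      (Nat.card {ℓ : ℕ // ℓ ≤ X ∧ ℓ.Prime ∧ ∃ x : ZMod ℓ, Polynomial.aeval x f = 0} : ℝ) /
      (Nat.card {ℓ : ℕ // ℓ ≤ X ∧ ℓ.Prime} : ℝ))
    Filter.atTop (nhds 1)

/-- The operator `k ↦ k' f + a f' k`, which satisfies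
`(k f^a)' = twistedDerivative f a k * f^(a-1)`. -/
noncomputable def twistedDerivative {K : Type*} [Field K] (f : K[X]) (a : ℕ) : K[X] →ₗ[K] K[X] :=
  LinearMap.mulLeft K f ∘ₗ derivative + LinearMap.mulLeft K (C (a : K) * derivative f)

/-- The `l`-fold iterate of `twistedDerivative`, with exponents `a, a - 1, …`. -/
noncomputable def twistedIterate {K : Type*} [Field K] (f : K[X]) (a : ℕ) : ℕ → K[X] →ₗ[K] K[X]
  | 0 => LinearMap.id
  | l + 1 => twistedDerivative f (a - l) ∘ₗ twistedIterate f a l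

section Stepanov

variable {K : Type*} [Field K]

theorem twistedDerivative_apply (f k : K[X]) (a : ℕ) :
    twistedDerivative f a k = f * derivative k + C (a : K) * derivative f * k := by
  simp [twistedDerivative, mul_assoc]

theorem iterate_derivative_mul_pow_mul (f k g : K[X]) (hg : derivative g = 0) (a l : ℕ)
    (hl : l ≤ a) :
    derivative^[l] (k * f ^ a * g) = twistedIterate f a l k * f ^ (a - l) * g := by
  induction l with
  | zero => simp [twistedIterate]
  | succ l ih =>
    rw [Function.iterate_succ_apply', ih (by omega)]
    obtain ⟨b, hb⟩ : ∃ b, a - l = b + 1 := ⟨a - l - 1, by omega⟩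
    have hb' : a - (l + 1) = b := by omega
    simp only [twistedIterate, LinearMap.comp_apply, twistedDerivative_apply, hb, hb',
      derivative_mul, hg, derivative_pow_succ]
    push_cast
    simp only [map_add, map_natCast, map_one]
    ring

theorem natDegree_twistedIterate_le (f k : K[X]) (a m l : ℕ) (hm : f.natDegree ≤ m) :
    (twistedIterate f a l k).natDegree ≤ k.natDegree + l * m := by
  induction l with
  | zero => simp [twistedIterate]
  | succ l ih =>
    simp only [twistedIterate, LinearMap.comp_apply, twistedDerivative_apply]
    refine (natDegree_add_le _ _).trans (max_le ?_ ?_)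
    · refine natDegree_mul_le.trans ?_
      have := natDegree_derivative_le (twistedIterate f a l k)
      rw [add_mul]
      omega
    · refine natDegree_mul_le.trans ?_
      have h1 : (C ((a - l : ℕ) : K) * derivative f).natDegree ≤ m :=
        (natDegree_C_mul_le _ _).trans ((natDegree_derivative_le f).trans (by omega))
      rw [add_mul]
      omega

/-- Linear independence underlying the non-vanishing of the auxiliary polynomial: the summands
have distinct orders of vanishing at the simple root `α`. -/
theorem coeff_family_eq_zero {p e q J : ℕ} (hqe : q * e < p) (h : K[X]) (α : K)
    (hα : h.eval α ≠ 0) (k : Fin J × Fin e → K[X]) (hk : ∀ a, (k a).degree < q)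
    (hsum : ∑ a, k a * ((X - C α) * h) ^ (q * a.2.1) * (X - C α) ^ (p * a.1.1) = 0) :
    k = 0 := by
  classical
  by_contra hne
  obtain ⟨a₁, ha₁⟩ := Function.ne_iff.1 hne
  obtain ⟨a₀, ha₀, hmin⟩ := Finset.exists_min_image (Finset.univ.filter fun a => k a ≠ 0)
    (fun a => q * a.2.1 + p * a.1.1) ⟨a₁, by simpa using ha₁⟩
  simp only [Finset.mem_filter, Finset.mem_univ, true_and] at ha₀ hmin
  set w := q * a₀.2.1 + p * a₀.1.1 with hw
  have hdvd : ∀ a, a ≠ a₀ → (X - C α) ^ (w + q) ∣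
      k a * ((X - C α) * h) ^ (q * a.2.1) * (X - C α) ^ (p * a.1.1) := by
    intro a ha
    by_cases hka : k a = 0
    · simp [hka]
    have h1 := hmin a hka
    have h2 : w + q ≤ q * a.2.1 + p * a.1.1 := by
      rcases lt_trichotomy a.1.1 a₀.1.1 with hlt | heq | hgt
      · exfalso
        have : q * a.2.1 ≤ q * e := Nat.mul_le_mul_left _ a.2.2.le
        have : p * (a.1.1 + 1) ≤ p * a₀.1.1 := Nat.mul_le_mul_left _ hlt
        rw [mul_add] at this
        omega
      · rcases lt_trichotomy a.2.1 a₀.2.1 with hlt' | heq' | hgt'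
        · exfalso
          have : q * (a.2.1 + 1) ≤ q * a₀.2.1 := Nat.mul_le_mul_left _ hlt'
          rw [mul_add] at this
          rcases Nat.eq_zero_or_pos q with hq | hq
          · have := hk a
            rw [hq] at this
            exact hka (by simpa using this)
          rw [heq] at h1
          omega
        · exact absurd (Prod.ext (Fin.ext heq) (Fin.ext heq')) ha
        · have : q * (a₀.2.1 + 1) ≤ q * a.2.1 := Nat.mul_le_mul_left _ hgt'
          rw [mul_add] at this
          rw [hw, heq]
          omega
      · have : q * (a₀.2.1 + 1) ≤ q * e := Nat.mul_le_mul_left _ a₀.2.2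
        have : p * (a₀.1.1 + 1) ≤ p * a.1.1 := Nat.mul_le_mul_left _ hgt
        rw [mul_add] at *
        omega
    refine (pow_dvd_pow _ h2).trans ⟨k a * h ^ (q * a.2.1), ?_⟩
    rw [mul_pow, pow_add]
    ring
  rw [← Finset.add_sum_erase _ _ (Finset.mem_univ a₀)] at hsum
  have h3 : (X - C α) ^ (w + q) ∣
      k a₀ * ((X - C α) * h) ^ (q * a₀.2.1) * (X - C α) ^ (p * a₀.1.1) := by
    rw [eq_neg_of_add_eq_zero_left hsum, dvd_neg]
    exact Finset.dvd_sum fun a ha => hdvd a (Finset.ne_of_mem_erase ha)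
  have h4 : (X - C α) ^ w * (X - C α) ^ q ∣
      (X - C α) ^ w * (k a₀ * h ^ (q * a₀.2.1)) := by
    rw [← pow_add]
    convert h3 using 1
    rw [mul_pow, hw, pow_add]
    ring
  have h5 := (mul_dvd_mul_iff_left (pow_ne_zero w (X_sub_C_ne_zero α))).1 h4
  have hcop : IsCoprime ((X - C α) ^ q) (h ^ (q * a₀.2.1)) := by
    apply IsCoprime.pow
    refine (irreducible_X_sub_C α).coprime_iff_not_dvd.2 ?_
    rw [dvd_iff_isRoot]
    exact hα
  have h6 := degree_le_of_dvd (hcop.dvd_of_dvd_mul_right h5) ha₀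
  rw [degree_pow, degree_X_sub_C] at h6
  have h7 := hk a₀
  simp only [nsmul_eq_mul, mul_one] at h6
  exact absurd h7 (not_lt.2 h6)

/-- A form of Stepanov's bound: the values `f(x)^q` on the prime field cannot avoid a class. -/
theorem stepanov {p e q M m : ℕ} [Fact p.Prime] [CharP K p] (hqe : q * e < p)
    (hM : M = e * (m + 1) + 1) (hq : e * M * (M * m + M) < q)
    (h : K[X]) (α : K) (hα : h.eval α ≠ 0) (hf : ((X - C α) * h).natDegree ≤ m)
    (S Z : Finset K) (hS : S.card = p) (hSp : ∀ x ∈ S, x ^ p = x) (hZ : Z.card < e)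
    (hSZ : ∀ x ∈ S, ((X - C α) * h).eval x = 0 ∨ ((X - C α) * h).eval x ^ q ∈ Z) : False := by
  classical
  set f := (X - C α) * h with hfdef
  have he : 0 < e := by omega
  obtain ⟨J, hJ⟩ : ∃ J, M = J + (m + 1) := ⟨e * (m + 1) + 1 - (m + 1), by
    have : 1 * (m + 1) ≤ e * (m + 1) := Nat.mul_le_mul_right _ he
    omega⟩
  set D := q + M * m + J with hD
  let poly : (((Fin J × Fin e) × Fin q) → K) →ₗ[K] (Fin J × Fin e) → K[X] :=
    LinearMap.pi fun a => ∑ b : Fin q, (monomial b.1 : K →ₗ[K] K[X]) ∘ₗ LinearMap.proj (a, b)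
  have hpoly : ∀ c a, poly c a = ∑ b : Fin q, monomial b.1 (c (a, b)) := by
    intro c a
    simp [poly]
  have hpolydeg : ∀ c a, (poly c a).degree < q := by
    intro c a
    rw [hpoly]
    refine (degree_sum_le _ _).trans_lt ((Finset.sup_lt_iff (WithBot.bot_lt_coe q)).2 ?_)
    intro b _
    exact (degree_monomial_le _ _).trans_lt (Nat.cast_lt.2 b.2)
  have hpolyinj : ∀ c, poly c = 0 → c = 0 := by
    intro c hc
    ext ⟨a, b⟩
    have h1 : (poly c a).coeff b.1 = 0 := by rw [hc]; simp
    rw [hpoly, finsetSum_coeff] at h1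
    simp only [coeff_monomial] at h1
    rw [Finset.sum_eq_single b] at h1
    · simpa using h1
    · intro b' _ hb'
      exact if_neg fun h => hb' (Fin.ext h)
    · simp
  let red : ℕ → K → ((Fin J × Fin e) → K[X]) →ₗ[K] K[X] := fun l z =>
    ∑ a : Fin J × Fin e, LinearMap.mulRight K ((X - C (α ^ p)) ^ a.1.1 * C (z ^ a.2.1)) ∘ₗ
      twistedIterate f (M + q * a.2.1) l ∘ₗ LinearMap.proj a
  have hred : ∀ l z k, red l z k = ∑ a : Fin J × Fin e,
      twistedIterate f (M + q * a.2.1) l (k a) * ((X - C (α ^ p)) ^ a.1.1 * C (z ^ a.2.1)) := by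
    intro l z k
    simp [red, mul_assoc]
  let Φ : (((Fin J × Fin e) × Fin q) → K) →ₗ[K] ((Fin M × Z) × Fin D → K) :=
    LinearMap.pi fun s => lcoeff K s.2.1 ∘ₗ red s.1.1.1 s.1.2.1 ∘ₗ poly
  have hdim : Module.finrank K ((Fin M × Z) × Fin D → K) <
      Module.finrank K (((Fin J × Fin e) × Fin q) → K) := by
    simp only [Module.finrank_fintype_fun_eq_card, Fintype.card_prod, Fintype.card_fin,
      Fintype.card_coe]
    obtain ⟨e', rfl⟩ : ∃ e', e = e' + 1 := ⟨e - 1, by omega⟩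
    have h1 : M * Z.card * D ≤ M * e' * D := by gcongr; omega
    have h2 : J * (e' + 1) = M * e' + 1 := by
      have : J + m + 1 = (e' + 1) * (m + 1) + 1 := by omega
      rw [hJ]
      nlinarith
    have h3 : J ≤ M := by omega
    rw [h2]
    have h4 : M * e' * (M * m + J) ≤ (e' + 1) * M * (M * m + M) := by
      rw [mul_comm M e']
      gcongr
      omega
    calc M * Z.card * D ≤ M * e' * D := h1
      _ = M * e' * q + M * e' * (M * m + J) := by rw [hD]; ring
      _ < M * e' * q + q := by omega
      _ = _ := by ring
  obtain ⟨c, hc, hc0⟩ := (Submodule.ne_bot_iff _).1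
    (LinearMap.ker_ne_bot_of_finrank_lt (f := Φ) hdim)
  set k := poly c with hkdef
  have hk0 : k ≠ 0 := fun h => hc0 (hpolyinj c h)
  have hred0 : ∀ l, l < M → ∀ z ∈ Z, red l z k = 0 := by
    intro l hl z hz
    have hdeg : (red l z k).natDegree < D := by
      rw [hred]
      refine (natDegree_sum_le_of_forall_le (n := D - 1) _ _ ?_).trans_lt (by omega)
      intro a _
      have h1 := natDegree_twistedIterate_le f (k a) (M + q * a.2.1) m l hf
      have h2 : (k a).natDegree < q := by
        rcases eq_or_ne (k a) 0 with h0 | h0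
        · rw [h0]; simp; omega
        · exact (natDegree_lt_iff_degree_lt h0).2 (hpolydeg c a)
      have h3 : ((X - C (α ^ p)) ^ a.1.1 * C (z ^ a.2.1)).natDegree ≤ a.1.1 := by
        refine (natDegree_mul_C_le _ _).trans ?_
        rw [natDegree_pow, natDegree_X_sub_C, mul_one]
      have h4 := a.1.2
      have h5 : l * m ≤ M * m := Nat.mul_le_mul_right _ hl.le
      refine natDegree_mul_le.trans ?_
      omega
    ext r
    by_cases hr : r < D
    · have := congrFun (LinearMap.mem_ker.1 hc) ((⟨l, hl⟩, ⟨z, hz⟩), ⟨r, hr⟩)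
      simpa [Φ] using this
    · rw [coeff_eq_zero_of_natDegree_lt (by omega)]
      simp
  have hfrob : ∀ j : ℕ, (X - C α) ^ (p * j) = ((X ^ p - C (α ^ p)) ^ j : K[X]) := by
    intro j
    rw [pow_mul, sub_pow_char, ← C_pow]
  set R := ∑ a : Fin J × Fin e, k a * f ^ (M + q * a.2.1) * (X - C α) ^ (p * a.1.1) with hR
  have hRf : R = f ^ M * ∑ a, k a * f ^ (q * a.2.1) * (X - C α) ^ (p * a.1.1) := by
    rw [hR, Finset.mul_sum]
    refine Finset.sum_congr rfl fun a _ => ?_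
    rw [pow_add]
    ring
  have hf0 : f ≠ 0 := by
    refine mul_ne_zero (X_sub_C_ne_zero α) ?_
    rintro rfl
    simp at hα
  have hR0 : R ≠ 0 := by
    rw [hRf]
    refine mul_ne_zero (pow_ne_zero _ hf0) fun h0 => hk0 ?_
    exact coeff_family_eq_zero hqe h α hα k (hpolydeg c) h0
  have hMpos : 0 < M := by omega
  have hMq : M * m + M < q := by
    refine lt_of_le_of_lt ?_ hq
    exact Nat.le_mul_of_pos_left _ (Nat.mul_pos he hMpos)
  have hqp : q < p := lt_of_le_of_lt (Nat.le_mul_of_pos_right q he) hqe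
  have hmult : ∀ x ∈ S, (X - C x) ^ M ∣ R := by
    intro x hx
    rcases hSZ x hx with h0 | hz
    · rw [hRf]
      exact Dvd.dvd.mul_right (pow_dvd_pow_of_dvd (dvd_iff_isRoot.2 h0) _) _
    · rw [← le_rootMultiplicity_iff hR0]
      obtain ⟨M', rfl⟩ : ∃ M', M = M' + 1 := ⟨M - 1, by omega⟩
      refine lt_rootMultiplicity_of_isRoot_iterate_derivative_of_mem_nonZeroDivisors hR0 ?_ ?_
      · intro l hl
        rw [IsRoot.def, hR, iterate_derivative_sum, eval_finsetSum]
        have h1 := congrArg (eval x) (hred0 l (by omega) _ hz)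
        rw [hred, eval_finsetSum, eval_zero] at h1
        have h2 : f.eval x ^ (M' + 1 - l) *
            ∑ a : Fin J × Fin e, eval x (twistedIterate f (M' + 1 + q * a.2.1) l (k a) *
              ((X - C (α ^ p)) ^ a.1.1 * C ((f.eval x ^ q) ^ a.2.1))) = 0 := by
          rw [h1, mul_zero]
        rw [Finset.mul_sum] at h2
        rw [← h2]
        refine Finset.sum_congr rfl fun a _ => ?_
        rw [iterate_derivative_mul_pow_mul _ _ _ _ _ _ (by omega), hfrob]
        · have h3 : M' + 1 + q * a.2.1 - l = (M' + 1 - l) + q * a.2.1 := by omega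
          rw [h3]
          simp only [eval_mul, eval_pow, eval_sub, eval_X, eval_C, hSp x hx]
          rw [pow_add, pow_mul]
          ring
        · rw [pow_mul', derivative_pow, CharP.cast_eq_zero]
          simp
      · rw [mem_nonZeroDivisors_iff_ne_zero, Ne, CharP.cast_eq_zero_iff K p,
          (Fact.out : p.Prime).dvd_factorial]
        omega
  have hprod : ∏ x ∈ S, (X - C x) ^ M ∣ R := by
    refine Finset.prod_dvd_of_coprime ?_ hmult
    intro x _ y _ hxy
    exact (isCoprime_X_sub_C_of_isUnit_sub (sub_ne_zero.2 hxy).isUnit).pow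
  have hlow := natDegree_le_of_dvd hprod hR0
  rw [natDegree_prod _ _ fun x _ => pow_ne_zero _ (X_sub_C_ne_zero x)] at hlow
  simp only [natDegree_pow, natDegree_X_sub_C, mul_one, Finset.sum_const, hS, smul_eq_mul] at hlow
  have hup : R.natDegree ≤ M * m + q + q * e * m + p * (J - 1) := by
    refine natDegree_sum_le_of_forall_le _ _ ?_
    intro a _
    have h2 : (k a).natDegree ≤ q := natDegree_le_of_degree_le (hpolydeg c a).le
    have h3 : (f ^ (M + q * a.2.1)).natDegree ≤ M * m + q * e * m := by
      rw [natDegree_pow, ← add_mul]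
      have := a.2.2.le
      gcongr
    have h4 : ((X - C α) ^ (p * a.1.1)).natDegree ≤ p * (J - 1) := by
      rw [natDegree_pow, natDegree_X_sub_C, mul_one]
      have := a.1.2
      gcongr
      omega
    refine natDegree_mul_le.trans ?_
    have := natDegree_mul_le (p := k a) (q := f ^ (M + q * a.2.1))
    omega
  have hJpos : 0 < J := by
    rcases Nat.eq_zero_or_pos J with h0 | h0
    · exfalso
      apply hk0
      subst h0
      ext a
      exact a.1.elim0
    · exact h0
  obtain ⟨J', rfl⟩ : ∃ J', J = J' + 1 := ⟨J - 1, by omega⟩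
  have h5 : q * e * m ≤ p * m := Nat.mul_le_mul_right _ hqe.le
  have h6 : p * M = p * J' + p * m + 2 * p := by rw [hJ]; ring
  simp only [Nat.add_sub_cancel] at hup
  omega

end Stepanov

theorem exists_twist_point_zmod (n m : ℕ) (hn : 0 < n) : ∃ B : ℕ, ∀ (p : ℕ) [Fact p.Prime], B < p →
    ∀ f : (ZMod p)[X], f.natDegree ≤ m → 0 < f.natDegree → IsCoprime f (derivative f) →
    ∀ d : ZMod p, d ≠ 0 → ∃ x y : ZMod p, y ≠ 0 ∧ d * y ^ n = f.eval x := by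
  classical
  set M' := n * (m + 1) + 1 with hM'
  refine ⟨n * (n * M' * (M' * m + M') + 1), ?_⟩
  intro p hp hB f hfm hf0 hcop d hd
  have hp1 : 0 < p - 1 := by have := hp.out.two_le; omega
  set e := n.gcd (p - 1) with he
  obtain ⟨q, hq⟩ : e ∣ p - 1 := Nat.gcd_dvd_right _ _
  have hen : e ≤ n := Nat.gcd_le_left _ hn
  have he0 : 0 < e := Nat.gcd_pos_of_pos_left _ hn
  have hcard : Nat.card (ZMod p)ˣ = p - 1 := by
    rw [Nat.card_eq_fintype_card, ZMod.card_units]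
  suffices hx : ∃ x, f.eval x ^ q = d ^ q by
    obtain ⟨x, hx⟩ := hx
    have hfx : f.eval x ≠ 0 := by
      intro h0
      rw [h0, zero_pow] at hx
      · exact pow_ne_zero _ hd hx.symm
      · rintro rfl
        omega
    obtain ⟨g, hg⟩ := IsCyclic.exists_generator (α := (ZMod p)ˣ)
    set u : (ZMod p)ˣ := Units.mk0 _ hfx / Units.mk0 _ hd with hu
    have huq : u ^ q = 1 := by
      ext
      simp [hu, div_pow, hx, hd]
    obtain ⟨k, hk⟩ := (Subgroup.mem_zpowers_iff).1 (hg u)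
    have hord : orderOf g = p - 1 := by
      rw [← hcard, ← Nat.card_zpowers, (Subgroup.eq_top_iff' _).2 hg, Subgroup.card_top]
    have h1 : (e : ℤ) ∣ k := by
      have h2 : g ^ (k * q) = 1 := by rw [zpow_mul, hk]; exact_mod_cast huq
      have h3 := orderOf_dvd_iff_zpow_eq_one.2 h2
      rw [hord, hq] at h3
      push_cast at h3
      have hq0 : (q : ℤ) ≠ 0 := by
        rintro h0
        have : q = 0 := by exact_mod_cast h0
        rw [this] at hq
        omega
      exact (mul_dvd_mul_iff_right hq0).1 h3
    obtain ⟨t, rfl⟩ := h1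
    have hbez := Nat.gcd_eq_gcd_ab n (p - 1)
    rw [← he] at hbez
    refine ⟨x, ((g ^ (n.gcdA (p - 1) * t) : (ZMod p)ˣ) : ZMod p), Units.ne_zero _, ?_⟩
    have h4 : (g ^ (n.gcdA (p - 1) * t)) ^ n = u := by
      rw [← hk, hbez, ← zpow_natCast, ← zpow_mul]
      have h5 : ((n : ℤ) * n.gcdA (p - 1) + ((p - 1 : ℕ) : ℤ) * n.gcdB (p - 1)) * t =
          n.gcdA (p - 1) * t * n + ((p - 1 : ℕ) : ℤ) * (n.gcdB (p - 1) * t) := by ring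
      rw [h5, zpow_add, zpow_mul g ((p - 1 : ℕ) : ℤ), zpow_natCast g (p - 1), ← hord,
        pow_orderOf_eq_one, one_zpow, mul_one]
    have h6 := congrArg (Units.val) h4
    rw [Units.val_pow_eq_pow_val] at h6
    rw [h6, hu]
    simp only [Units.val_div_eq_div_val, Units.val_mk0]
    field_simp
  by_contra! hno
  let L := AlgebraicClosure (ZMod p)
  have : CharP L p := charP_of_injective_algebraMap (algebraMap (ZMod p) L).injective p
  obtain ⟨α, hα⟩ := IsAlgClosed.exists_root (f.map (algebraMap (ZMod p) L)) (by
    rw [degree_map]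
    exact (natDegree_pos_iff_degree_pos.1 hf0).ne')
  obtain ⟨h, hh⟩ := dvd_iff_isRoot.2 hα
  have hhα : h.eval α ≠ 0 := by
    intro h0
    obtain ⟨a, b, hab⟩ := hcop
    have := congrArg (fun g => (g.map (algebraMap (ZMod p) L)).eval α) hab
    simp only [Polynomial.map_add, Polynomial.map_mul, ← derivative_map, hh] at this
    simp [h0] at this
  let S : Finset L := Finset.univ.image (algebraMap (ZMod p) L)
  let Z₀ : Finset (ZMod p) := (nthRootsFinset e (1 : ZMod p)).erase (d ^ q)
  have hmem : ∀ z : ZMod p, z ≠ 0 → z ^ q ∈ nthRootsFinset e (1 : ZMod p) := by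
    intro z hz
    rw [mem_nthRootsFinset he0, ← pow_mul, mul_comm, ← hq]
    exact ZMod.pow_card_sub_one_eq_one hz
  have hMe : e * (m + 1) + 1 ≤ M' := by rw [hM']; gcongr
  refine stepanov (p := p) (e := e) (q := q) (M := e * (m + 1) + 1) (m := m) ?_ rfl ?_ h α hhα ?_ S
    (Z₀.image (algebraMap (ZMod p) L)) ?_ ?_ ?_ ?_
  · rw [mul_comm, ← hq]; omega
  · have h1 : e * (e * (m + 1) + 1) * ((e * (m + 1) + 1) * m + (e * (m + 1) + 1)) ≤
        n * M' * (M' * m + M') := by gcongr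
    refine h1.trans_lt ?_
    have h2 : e * q ≤ n * q := Nat.mul_le_mul_right _ hen
    have h3 : n * (n * M' * (M' * m + M') + 1) ≤ n * q := by omega
    have := Nat.le_of_mul_le_mul_left h3 hn
    omega
  · rw [← hh]
    exact natDegree_map_le.trans hfm
  · rw [Finset.card_image_of_injective _ (algebraMap (ZMod p) L).injective, Finset.card_univ,
      ZMod.card]
  · intro x hx
    obtain ⟨y, -, rfl⟩ := Finset.mem_image.1 hx
    rw [← map_pow, ZMod.pow_card]
  · refine Finset.card_image_le.trans_lt ?_
    have h1 := Finset.card_erase_lt_of_mem (hmem d hd)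
    refine h1.trans_le ?_
    rw [nthRootsFinset_def]
    exact (Multiset.toFinset_card_le _).trans (card_nthRoots _ _)
  · intro x hx
    obtain ⟨y, -, rfl⟩ := Finset.mem_image.1 hx
    rw [← hh, eval_map_algebraMap, aeval_algebraMap_apply_eq_algebraMap_eval]
    by_cases hy : f.eval y = 0
    · left; rw [hy, map_zero]
    · right
      rw [← map_pow]
      exact Finset.mem_image_of_mem _ (Finset.mem_erase.2 ⟨hno y, hmem _ hy⟩)

theorem exists_nthPowerFree_mul_pow (n : ℕ) (hn : n ≠ 0) (D : ℤ) (hD : D ≠ 0) :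
    ∃ d s : ℤ, NthPowerFree n d ∧ D = d * s ^ n := by
  induction hk : D.natAbs using Nat.strong_induction_on generalizing D with
  | _ k ih =>
    by_cases hfree : NthPowerFree n D
    · exact ⟨D, 1, hfree, by simp⟩
    · simp only [NthPowerFree, not_and, not_forall, not_not] at hfree
      obtain ⟨p, hp, D', rfl⟩ := hfree hD
      have hD' : D' ≠ 0 := right_ne_zero_of_mul hD
      have hlt : D'.natAbs < k := by
        rw [← hk, Int.natAbs_mul, Int.natAbs_pow, Int.natAbs_natCast]
        have h1 := Int.natAbs_pos.2 hD'
        have h2 := Nat.one_lt_pow hn hp.one_lt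
        nlinarith
      obtain ⟨d, s, hd, hds⟩ := ih _ hlt D' hD' rfl
      exact ⟨d, p * s, hd, by rw [hds]; ring⟩

theorem exists_bezout_derivative (f : ℤ[X]) (hsf : Squarefree (f.map (Int.castRingHom ℚ))) :
    ∃ (R : ℤ) (u v : ℤ[X]), R ≠ 0 ∧ u * f + v * derivative f = C R := by
  have hsep := PerfectField.separable_iff_squarefree.2 hsf
  obtain ⟨a, b, hab⟩ := hsep
  obtain ⟨r, hr, hr'⟩ := IsLocalization.integerNormalization_spec (nonZeroDivisors ℤ) a
  obtain ⟨s, hs, hs'⟩ := IsLocalization.integerNormalization_spec (nonZeroDivisors ℤ) b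
  rw [mem_nonZeroDivisors_iff_ne_zero] at hr hs
  refine ⟨r * s, C s * IsLocalization.integerNormalization (nonZeroDivisors ℤ) a,
    C r * IsLocalization.integerNormalization (nonZeroDivisors ℤ) b, mul_ne_zero hr hs, ?_⟩
  apply map_injective (Int.castRingHom ℚ) Int.cast_injective
  rw [algebraMap_int_eq] at hr' hs'
  simp only [Polynomial.map_add, Polynomial.map_mul, hr', hs', ← derivative_map,
    zsmul_eq_mul, eq_intCast, Polynomial.map_intCast, Int.cast_mul]
  linear_combination (r : ℚ[X]) * (s : ℚ[X]) * hab

theorem padic_exists_root_of_one {p : ℕ} [Fact p.Prime] (n : ℕ) (W e : ℤ) (hp : (p : ℤ) ∣ W)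
    (hn : (n : ℤ) ∣ W) (hW : W ≠ 0) (he : W ^ 3 ∣ e - 1) :
    ∃ w : ℤ_[p], w ^ n = (e : ℤ_[p]) := by
  have hder : aeval (1 : ℤ_[p]) (derivative (X ^ n - C (e : ℤ_[p]))) = (n : ℤ_[p]) := by
    rw [derivative_sub, derivative_C, derivative_X_pow]
    simp
  have hval : aeval (1 : ℤ_[p]) (X ^ n - C (e : ℤ_[p])) = ((1 - e : ℤ) : ℤ_[p]) := by
    simp
  have hWn : ‖(W : ℤ_[p])‖ ≤ ‖(n : ℤ_[p])‖ := by
    obtain ⟨c, hc⟩ := hn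
    rw [hc]
    push_cast
    rw [norm_mul]
    exact mul_le_of_le_one_right (norm_nonneg _) (PadicInt.norm_le_one _)
  have hW1 : ‖(W : ℤ_[p])‖ < 1 := (PadicInt.norm_int_lt_one_iff_dvd _).2 hp
  have hWpos : 0 < ‖(W : ℤ_[p])‖ := norm_pos_iff.2 (by exact_mod_cast hW)
  have hlt : ‖((1 - e : ℤ) : ℤ_[p])‖ < ‖(n : ℤ_[p])‖ ^ 2 := by
    obtain ⟨c, hc⟩ := he
    have : (1 - e : ℤ) = W ^ 3 * (-c) := by linarith
    rw [this]
    push_cast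
    rw [norm_mul, norm_pow]
    calc _ ≤ ‖(W : ℤ_[p])‖ ^ 3 :=
          mul_le_of_le_one_right (by positivity) (PadicInt.norm_le_one _)
      _ < ‖(W : ℤ_[p])‖ ^ 2 := pow_lt_pow_right_of_lt_one₀ hWpos hW1 (by norm_num)
      _ ≤ _ := by gcongr
  obtain ⟨z, hz, -⟩ := hensels_lemma (F := X ^ n - C (e : ℤ_[p])) (a := 1)
    (by rw [hder, hval]; exact hlt)
  refine ⟨z, ?_⟩
  simpa [sub_eq_zero] using hz

theorem padic_norm_int_eq_one {p : ℕ} [Fact p.Prime] {k : ℤ} (h : ¬ (p : ℤ) ∣ k) :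
    ‖(k : ℤ_[p])‖ = 1 :=
  le_antisymm (PadicInt.norm_le_one _) (not_lt.1 fun hlt =>
    h ((PadicInt.norm_int_lt_one_iff_dvd _).1 hlt))

theorem padic_exists_root_of_simple {p : ℕ} [Fact p.Prime] (F : ℤ[X]) (a : ℤ)
    (h0 : (p : ℤ) ∣ F.eval a) (h1 : ¬ (p : ℤ) ∣ (derivative F).eval a) :
    ∃ z : ℤ_[p], aeval z F = 0 := by
  have hev : ∀ G : ℤ[X], aeval (a : ℤ_[p]) G = ((G.eval a : ℤ) : ℤ_[p]) := by
    intro G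
    rw [aeval_def, eval₂_at_intCast]
    simp
  obtain ⟨z, hz, -⟩ := hensels_lemma (F := F) (a := (a : ℤ_[p])) (by
    rw [hev, hev, padic_norm_int_eq_one h1, one_pow]
    exact (PadicInt.norm_int_lt_one_iff_dvd _).2 h0)
  exact ⟨z, hz⟩

theorem HasTwistPoint.of_zero {n : ℕ} (hn : n ≠ 0) {f : ℤ[X]} {p : ℕ} [Fact p.Prime] (d : ℤ)
    (h : ∃ z : ℤ_[p], aeval z f = 0) : HasTwistPoint n f d ℚ_[p] := by
  obtain ⟨z, hz⟩ := h
  refine ⟨(z : ℚ_[p]), 0, ?_⟩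
  have h1 : aeval (algebraMap ℤ_[p] ℚ_[p] z) f = 0 := by
    rw [aeval_algebraMap_apply, hz, map_zero]
  rw [zero_pow hn, mul_zero]
  exact h1.symm

theorem HasTwistPoint.of_zmod {n : ℕ} {f : ℤ[X]} {p : ℕ} [Fact p.Prime] {d : ℤ}
    (hd : ¬ (p : ℤ) ∣ d) (hpn : ¬ (p : ℤ) ∣ n) (x y : ZMod p) (hy : y ≠ 0)
    (h : (d : ZMod p) * y ^ n = (f.map (Int.castRingHom (ZMod p))).eval x) :
    HasTwistPoint n f d ℚ_[p] := by
  obtain ⟨x, rfl⟩ := ZMod.intCast_surjective x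
  obtain ⟨y, rfl⟩ := ZMod.intCast_surjective y
  have hy' : ¬ (p : ℤ) ∣ y := by rwa [Ne, ZMod.intCast_zmod_eq_zero_iff_dvd] at hy
  have hpp : Prime (p : ℤ) := Nat.prime_iff_prime_int.1 Fact.out
  obtain ⟨z, hz⟩ := padic_exists_root_of_simple (p := p) (C d * X ^ n - C (f.eval x)) y (by
    rw [← ZMod.intCast_zmod_eq_zero_iff_dvd]
    rw [eval_intCast_map] at h
    simp only [eval_sub, eval_mul, eval_C, eval_pow, eval_X]
    push_cast
    rw [h]
    simp) (by
    simp only [derivative_sub, derivative_mul, derivative_C, zero_mul, derivative_X_pow, zero_add,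
      sub_zero, eval_mul, eval_C, eval_pow, eval_X]
    intro hdvd
    rcases hpp.dvd_or_dvd hdvd with h1 | h1
    · exact hd h1
    · rcases hpp.dvd_or_dvd h1 with h2 | h2
      · exact hpn (by simpa using h2)
      · exact hy' (hpp.dvd_of_dvd_pow h2))
  refine ⟨(x : ℚ_[p]), (z : ℚ_[p]), ?_⟩
  have h1 : (d : ℤ_[p]) * z ^ n = ((f.eval x : ℤ) : ℤ_[p]) := by
    simpa [sub_eq_zero] using hz
  have h2 := congrArg (fun t : ℤ_[p] => (t : ℚ_[p])) h1
  push_cast at h2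
  rw [h2, aeval_def, eval₂_at_intCast]
  simp

theorem HasTwistPoint.mul_pow {n : ℕ} {f : ℤ[X]} {d : ℤ} {K : Type} [Field K] {e : ℤ}
    (x y w : K) (h : (d : K) * y ^ n = aeval x f) (hw : w ^ n = e) (hw0 : w ≠ 0) :
    HasTwistPoint n f (d * e) K := by
  refine ⟨x, y / w, ?_⟩
  rw [← h, Int.cast_mul, ← hw, div_pow]
  field_simp

/-- Twists by squarefree integers congruent to one modulo `N` and composed of primes modulo which
`f` has a root are everywhere locally soluble, for suitable `N` and base twist `d₀`. -/
theorem exists_modulus_everywhereLocallySoluble (n : ℕ) (hn : 2 ≤ n) (f : ℤ[X])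
    (hsf : Squarefree (f.map (Int.castRingHom ℚ))) (hdeg : 0 < f.natDegree) :
    ∃ N : ℕ, 0 < N ∧ ∃ d₀ : ℤ, d₀ ≠ 0 ∧ ∀ e : ℕ, Squarefree e → (N : ℤ) ∣ (e : ℤ) - 1 →
      (∀ p : ℕ, p.Prime → p ∣ e → ∃ x : ℤ, (p : ℤ) ∣ f.eval x) →
      NthPowerFree n (d₀ * e) ∧ EverywhereLocallySoluble n f (d₀ * e) := by
  have hf0 : f ≠ 0 := by rintro rfl; simp at hdeg
  obtain ⟨R, u, v, hR, huv⟩ := exists_bezout_derivative f hsf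
  obtain ⟨B, hB⟩ := exists_twist_point_zmod n f.natDegree (by omega)
  obtain ⟨x₀, hx₀⟩ : ∃ x : ℤ, f.eval x ≠ 0 := by
    by_contra! h
    exact hf0 (Polynomial.funext fun x => by simpa using h x)
  obtain ⟨d₀, s, hd₀, hds⟩ := exists_nthPowerFree_mul_pow n (by omega) _ hx₀
  set W : ℤ := n * f.leadingCoeff * d₀ * R * (B.factorial : ℤ) with hW
  have hn0 : (n : ℤ) ≠ 0 := by positivity
  have hlc : f.leadingCoeff ≠ 0 := leadingCoeff_ne_zero.2 hf0
  have hB0 : (B.factorial : ℤ) ≠ 0 := by exact_mod_cast B.factorial_ne_zero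
  have hW0 : W ≠ 0 := by
    rw [hW]
    exact mul_ne_zero (mul_ne_zero (mul_ne_zero (mul_ne_zero hn0 hlc) hd₀.1) hR) hB0
  have dvd1 : (n : ℤ) ∣ W := ⟨f.leadingCoeff * d₀ * R * B.factorial, by rw [hW]; ring⟩
  have dvd2 : f.leadingCoeff ∣ W := ⟨n * d₀ * R * B.factorial, by rw [hW]; ring⟩
  have dvd3 : d₀ ∣ W := ⟨n * f.leadingCoeff * R * B.factorial, by rw [hW]; ring⟩
  have dvd4 : R ∣ W := ⟨n * f.leadingCoeff * d₀ * B.factorial, by rw [hW]; ring⟩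
  have dvd5 : (B.factorial : ℤ) ∣ W := ⟨n * f.leadingCoeff * d₀ * R, by rw [hW]; ring⟩
  refine ⟨(W ^ 3).natAbs, Int.natAbs_pos.2 (pow_ne_zero _ hW0), d₀, hd₀.1, ?_⟩
  intro e hsq he hroot
  rw [Int.natAbs_dvd] at he
  have hcop : ∀ p : ℕ, p.Prime → (p : ℤ) ∣ W → ¬ (p : ℤ) ∣ (e : ℤ) := by
    intro p hp hpW hpe
    have h1 : (p : ℤ) ∣ (e : ℤ) - 1 := (hpW.trans (dvd_pow_self W (by norm_num))).trans he
    have h2 : (p : ℤ) ∣ 1 := by simpa using dvd_sub hpe h1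
    exact hp.one_lt.ne' (by exact_mod_cast Int.eq_one_of_dvd_one (by positivity) h2)
  have he0 : (e : ℤ) ≠ 0 := by exact_mod_cast hsq.ne_zero
  refine ⟨⟨mul_ne_zero hd₀.1 he0, ?_⟩, ?_, ?_⟩
  · intro p hp hdvd
    have hpp : Prime (p : ℤ) := Nat.prime_iff_prime_int.1 hp
    by_cases hpe : (p : ℤ) ∣ (e : ℤ)
    · have h1 : ¬ (p : ℤ) ∣ d₀ := fun h => hcop p hp (h.trans dvd3) hpe
      have h2 : (p : ℤ) ^ n ∣ (e : ℤ) :=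
        ((hpp.coprime_iff_not_dvd.2 h1).pow_left).dvd_of_dvd_mul_left hdvd
      have h3 : p * p ∣ e := by
        rw [← sq]
        exact_mod_cast (pow_dvd_pow (p : ℤ) hn).trans h2
      exact hp.one_lt.ne' (by simpa using hsq p h3)
    · exact hd₀.2 p hp (((hpp.coprime_iff_not_dvd.2 hpe).pow_left).dvd_of_dvd_mul_right hdvd)
  · have hepos : (0 : ℝ) < e := by exact_mod_cast Nat.pos_of_ne_zero hsq.ne_zero
    refine HasTwistPoint.mul_pow (x₀ : ℝ) (s : ℝ) ((e : ℝ) ^ ((n : ℝ)⁻¹)) ?_ ?_ ?_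
    · rw [aeval_def, eval₂_at_intCast]
      simp [hds]
    · rw [Real.rpow_inv_natCast_pow hepos.le (by omega)]
      simp
    · positivity
  · intro p hp
    have hpp : Prime (p : ℤ) := Nat.prime_iff_prime_int.1 hp.out
    by_cases hpW : (p : ℤ) ∣ W
    · obtain ⟨w, hw⟩ := padic_exists_root_of_one n W e hpW dvd1 hW0 he
      have hw' : (w : ℚ_[p]) ^ n = ((e : ℤ) : ℚ_[p]) := by
        have := congrArg (fun t : ℤ_[p] => (t : ℚ_[p])) hw
        push_cast at this
        exact_mod_cast this
      refine HasTwistPoint.mul_pow (x₀ : ℚ_[p]) (s : ℚ_[p]) (w : ℚ_[p]) ?_ hw' ?_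
      · rw [aeval_def, eval₂_at_intCast]
        simp [hds]
      · intro h0
        rw [h0, zero_pow (by omega)] at hw'
        exact he0 (by exact_mod_cast hw'.symm)
    · by_cases hpe : (p : ℤ) ∣ (e : ℤ)
      · obtain ⟨x, hx⟩ := hroot p hp.out (by exact_mod_cast hpe)
        refine HasTwistPoint.of_zero (by omega) _ (padic_exists_root_of_simple f x hx ?_)
        intro hx'
        have h1 := congrArg (eval x) huv
        simp only [eval_add, eval_mul, eval_C] at h1
        exact hpW (Dvd.dvd.trans (h1 ▸ dvd_add (hx.mul_left _) (hx'.mul_left _)) dvd4)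
      · have hpd : ¬ (p : ℤ) ∣ d₀ * e := by
          intro h
          rcases hpp.dvd_or_dvd h with h | h
          · exact hpW (h.trans dvd3)
          · exact hpe h
        have hpB : B < p := by
          by_contra! hle
          exact hpW ((Int.natCast_dvd_natCast.2 (hp.out.dvd_factorial.2 hle)).trans dvd5)
        have hne : ((d₀ * e : ℤ) : ZMod p) ≠ 0 := by
          rwa [Ne, ZMod.intCast_zmod_eq_zero_iff_dvd]
        have hnd : (f.map (Int.castRingHom (ZMod p))).natDegree = f.natDegree := by
          refine natDegree_map_of_leadingCoeff_ne_zero _ ?_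
          rw [eq_intCast, Ne, ZMod.intCast_zmod_eq_zero_iff_dvd]
          exact fun h => hpW (h.trans dvd2)
        have hR' : (R : ZMod p) ≠ 0 := by
          rw [Ne, ZMod.intCast_zmod_eq_zero_iff_dvd]
          exact fun h => hpW (h.trans dvd4)
        have hcopd : IsCoprime (f.map (Int.castRingHom (ZMod p)))
            (derivative (f.map (Int.castRingHom (ZMod p)))) := by
          refine ⟨C ((R : ZMod p)⁻¹) * u.map (Int.castRingHom (ZMod p)),
            C ((R : ZMod p)⁻¹) * v.map (Int.castRingHom (ZMod p)), ?_⟩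
          have h1 := congrArg (Polynomial.map (Int.castRingHom (ZMod p))) huv
          simp only [Polynomial.map_add, Polynomial.map_mul, ← derivative_map, map_C] at h1
          rw [mul_assoc, mul_assoc, ← mul_add, h1, ← C_mul, eq_intCast, inv_mul_cancel₀ hR', C_1]
        obtain ⟨x, y, hy, hxy⟩ := hB p hpB _ hnd.le (by omega) hcopd _ hne
        exact HasTwistPoint.of_zmod hpd (fun h => hpW (h.trans dvd1)) x y hy hxy

section LatticeCount

variable {O ι : Type*} [CommRing O] [Fintype ι] (b : Module.Basis ι ℤ O)

theorem Module.Basis.exists_repr_mul_le : ∃ C : ℕ, ∀ (x y : O) (s t : ℤ),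
    (∀ i, |b.repr x i| ≤ s) → (∀ i, |b.repr y i| ≤ t) → ∀ k, |b.repr (x * y) k| ≤ C * s * t := by
  refine ⟨∑ k, ∑ i, ∑ j, (b.repr (b i * b j) k).natAbs, ?_⟩
  intro x y s t hx hy k
  have h1 : b.repr (x * y) k = ∑ i, ∑ j, b.repr x i * b.repr y j * b.repr (b i * b j) k := by
    conv_lhs => rw [← b.sum_repr x, ← b.sum_repr y, Finset.sum_mul_sum]
    simp only [map_sum, smul_mul_smul_comm, map_smul, Finsupp.finsetSum_apply, Finsupp.smul_apply,
      smul_eq_mul]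
  have hs : 0 ≤ s := (abs_nonneg _).trans (hx k)
  have ht : 0 ≤ t := (abs_nonneg _).trans (hy k)
  rw [h1]
  calc |∑ i, ∑ j, b.repr x i * b.repr y j * b.repr (b i * b j) k|
      ≤ ∑ i, ∑ j, |b.repr x i * b.repr y j * b.repr (b i * b j) k| :=
        (Finset.abs_sum_le_sum_abs _ _).trans
          (Finset.sum_le_sum fun i _ => Finset.abs_sum_le_sum_abs _ _)
    _ ≤ ∑ i, ∑ j, s * t * |b.repr (b i * b j) k| := by
        gcongr with i _ j _
        rw [abs_mul, abs_mul]
        gcongr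
        · exact hx i
        · exact hy j
    _ = (∑ i, ∑ j, |b.repr (b i * b j) k|) * s * t := by
        simp_rw [← Finset.mul_sum]
        ring
    _ ≤ _ := by
        gcongr
        push_cast
        exact Finset.single_le_sum (f := fun k => ∑ i, ∑ j, |b.repr (b i * b j) k|)
          (fun k _ => Finset.sum_nonneg fun i _ => Finset.sum_nonneg fun j _ => abs_nonneg _)
          (Finset.mem_univ k)

/-- The integer combination of the basis with natural number coordinates `v`. -/
noncomputable def natComb (v : ι → ℕ) : O := ∑ i, (v i : ℤ) • b i

theorem natComb_add (v w : ι → ℕ) : natComb b (v + w) = natComb b v + natComb b w := by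
  simp [natComb, add_smul, Finset.sum_add_distrib]

open Classical in
/-- The number of points of the coordinate box of side `H`, translated by `t`, in the ideal `I`. -/
noncomputable def boxCount (I : Ideal O) (t : O) (H : ℕ) : ℕ :=
  ((Fintype.piFinset fun _ : ι => Finset.range H).filter fun v => t + natComb b v ∈ I).card

theorem sum_boxCount (I : Ideal O) [Fintype (O ⧸ I)] (H : ℕ) :
    ∑ Q : O ⧸ I, boxCount b I Q.out H = H ^ Fintype.card ι := by
  classical
  have h1 : (Fintype.piFinset fun _ : ι => Finset.range H).card = H ^ Fintype.card ι := by
    simp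
  rw [← h1, Finset.card_eq_sum_card_fiberwise (t := (Finset.univ : Finset (O ⧸ I)))
    (f := fun v => -Ideal.Quotient.mk I (natComb b v)) (by simp)]
  refine Finset.sum_congr rfl fun Q _ => ?_
  unfold boxCount
  congr 1
  refine Finset.filter_congr fun v _ => ?_
  rw [← Ideal.Quotient.eq_zero_iff_mem, map_add]
  have : Ideal.Quotient.mk I Q.out = Q := Ideal.Quotient.mk_out Q
  rw [this, neg_eq_iff_add_eq_zero, add_comm]

variable [IsDedekindDomain O] [Module.Free ℤ O] [Module.Finite ℤ O]

theorem Ideal.exists_small_mem {I : Ideal O} (hI : I ≠ ⊥) (s : ℕ)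
    (hs : I.absNorm < (s + 1) ^ Fintype.card ι) :
    ∃ α ∈ I, α ≠ 0 ∧ ∀ i, |b.repr α i| ≤ s := by
  classical
  have hN : I.absNorm ≠ 0 := by rwa [Ne, Ideal.absNorm_eq_zero_iff]
  have hfin : Finite (O ⧸ I) := Ideal.finiteQuotientOfFreeOfNeBot I hI
  have := Fintype.ofFinite (O ⧸ I)
  have hcard : Fintype.card (O ⧸ I) = I.absNorm := by
    rw [Ideal.absNorm_apply, Submodule.cardQuot_apply, Nat.card_eq_fintype_card]
  obtain ⟨v, w, hvw, heq⟩ := Fintype.exists_ne_map_eq_of_card_lt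
    (fun v : ι → Fin (s + 1) => Ideal.Quotient.mk I (∑ i, ((v i : ℕ) : ℤ) • b i)) (by
      rw [hcard]
      simpa using hs)
  rw [Ideal.Quotient.mk_eq_mk_iff_sub_mem, ← Finset.sum_sub_distrib] at heq
  simp_rw [← sub_smul] at heq
  have hrepr : ∀ i, b.repr (∑ i, (((v i : ℕ) : ℤ) - ((w i : ℕ) : ℤ)) • b i) i =
      ((v i : ℕ) : ℤ) - ((w i : ℕ) : ℤ) := fun i => by rw [b.repr_sum_self]
  refine ⟨_, heq, ?_, ?_⟩
  · intro h0
    apply hvw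
    ext i
    have := hrepr i
    rw [h0, map_zero, Finsupp.zero_apply] at this
    omega
  · intro i
    rw [hrepr, abs_le]
    have h1 := (v i).2
    have h2 := (w i).2
    constructor <;> omega

theorem Ideal.exists_covering : ∃ C : ℕ, ∀ (I : Ideal O), I ≠ ⊥ → ∀ s : ℕ,
    I.absNorm < (s + 1) ^ Fintype.card ι → ∀ z : O, ∃ v : ι → ℕ, (∀ i, v i ≤ C * s) ∧
      natComb b v - z ∈ I := by
  obtain ⟨C, hC⟩ := b.exists_repr_mul_le
  refine ⟨2 * C, fun I hI s hs z => ?_⟩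
  obtain ⟨α, hαI, hα0, hα⟩ := Ideal.exists_small_mem b hI s hs
  set M : ℕ := (Ideal.span {α}).absNorm with hM
  have hM0 : (M : ℤ) ≠ 0 := by
    rw [hM]
    exact_mod_cast (by rwa [Ne, Ideal.absNorm_eq_zero_iff, Ideal.span_singleton_eq_bot] :
      (Ideal.span {α}).absNorm ≠ 0)
  obtain ⟨β, hβ⟩ := Ideal.mem_span_singleton'.1 (Ideal.absNorm_mem (Ideal.span {α}))
  rw [← hM] at hβ
  set z' : O := z - ∑ i, ((C * s : ℕ) : ℤ) • b i with hz'
  set q : O := ∑ i, (b.repr (z' * β) i / M) • b i with hq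
  set r : O := ∑ i, (b.repr (z' * β) i % M) • b i with hr
  have hqr : z' * β = M * q + r := by
    conv_lhs => rw [← b.sum_repr (z' * β)]
    rw [hq, hr, Finset.mul_sum, ← Finset.sum_add_distrib]
    refine Finset.sum_congr rfl fun i _ => ?_
    conv_lhs => rw [← Int.mul_ediv_add_emod (b.repr (z' * β) i) M]
    rw [add_smul, mul_smul]
    simp
  have hrepr : ∀ i, |b.repr r i| ≤ M := by
    intro i
    rw [hr, b.repr_sum_self, abs_of_nonneg (Int.emod_nonneg _ hM0)]
    exact (Int.emod_lt_of_pos _ (by positivity)).le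
  have hsmall : ∀ i, |b.repr (z' - α * q) i| ≤ C * s := by
    intro i
    have h1 : (M : ℤ) • (z' - α * q) = α * r := by
      rw [zsmul_eq_mul]
      push_cast
      linear_combination (-(z' : O)) * hβ + α * hqr
    have h2 := hC α r s M hα hrepr i
    rw [← h1, map_smul, Finsupp.smul_apply, smul_eq_mul, abs_mul, Nat.abs_cast, mul_comm] at h2
    exact le_of_mul_le_mul_right h2 (by positivity)
  refine ⟨fun i => (b.repr (z' - α * q) i + C * s).toNat, fun i => ?_, ?_⟩
  · have := abs_le.1 (hsmall i)
    have h2 : ((2 * C * s : ℕ) : ℤ) = 2 * (C * s) := by push_cast; ring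
    zify
    rw [Int.toNat_of_nonneg (by linarith)]
    push_cast at h2 ⊢
    linarith
  · have h1 : natComb b (fun i => (b.repr (z' - α * q) i + C * s).toNat) =
        (z' - α * q) + ∑ i, ((C * s : ℕ) : ℤ) • b i := by
      conv_rhs => rw [← b.sum_repr (z' - α * q)]
      rw [natComb, ← Finset.sum_add_distrib]
      refine Finset.sum_congr rfl fun i _ => ?_
      rw [← add_smul, Int.toNat_of_nonneg (by linarith [(abs_le.1 (hsmall i)).1])]
      push_cast
      rfl
    rw [h1, hz']
    have : z - ∑ i, ((C * s : ℕ) : ℤ) • b i - α * q + ∑ i, ((C * s : ℕ) : ℤ) • b i - z =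
        -(α * q) := by ring
    rw [this]
    exact I.neg_mem (I.mul_mem_right _ hαI)

/-- Counting points of a box lying in an ideal, uniformly in the ideal. -/
theorem exists_boxCount_bounds : ∃ C : ℕ, ∀ (I : Ideal O), I ≠ ⊥ → ∀ s : ℕ,
    I.absNorm < (s + 1) ^ Fintype.card ι → ∀ (t : O) (H : ℕ),
      H ^ Fintype.card ι ≤ I.absNorm * boxCount b I t (H + C * s) ∧
      I.absNorm * boxCount b I t H ≤ (H + C * s) ^ Fintype.card ι := by
  classical
  obtain ⟨C, hC⟩ := Ideal.exists_covering b
  refine ⟨C, fun I hI s hs t H => ?_⟩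
  have hfin : Finite (O ⧸ I) := Ideal.finiteQuotientOfFreeOfNeBot I hI
  have := Fintype.ofFinite (O ⧸ I)
  have hcard : I.absNorm = (Finset.univ : Finset (O ⧸ I)).card := by
    rw [Ideal.absNorm_apply, Submodule.cardQuot_apply, Nat.card_eq_fintype_card, Finset.card_univ]
  have key : ∀ t q H, boxCount b I q H ≤ boxCount b I t (H + C * s) := by
    intro t q H
    obtain ⟨v, hv, hvI⟩ := hC I hI s hs (q - t)
    refine Finset.card_le_card_of_injOn (· + v) ?_ (fun x _ y _ h => add_right_cancel h)
    intro a ha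
    simp only [Finset.coe_filter, Fintype.mem_piFinset, Finset.mem_range, Set.mem_ofPred_eq] at ha ⊢
    refine ⟨fun i => add_lt_add_of_lt_of_le (ha.1 i) (hv i), ?_⟩
    rw [natComb_add]
    have : t + (natComb b a + natComb b v) = (q + natComb b a) + (natComb b v - (q - t)) := by ring
    rw [this]
    exact I.add_mem ha.2 hvI
  constructor
  · rw [← sum_boxCount b I H, hcard, ← smul_eq_mul]
    exact Finset.sum_le_card_nsmul _ _ _ fun Q _ => key t _ H
  · rw [← sum_boxCount b I (H + C * s), hcard, ← smul_eq_mul]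
    exact Finset.card_nsmul_le_sum _ _ _ fun Q _ => key _ t H

end LatticeCount

section IdealVonMangoldt

open UniqueFactorizationMonoid

variable (O : Type*) [CommRing O] [IsDedekindDomain O] [Module.Free ℤ O] [Module.Finite ℤ O]
  [CharZero O]

theorem two_le_absNorm_of_prime {O : Type*} [CommRing O] [IsDedekindDomain O] [Module.Free ℤ O]
    [Module.Finite ℤ O] {P : Ideal O} (hP : Prime P) : 2 ≤ P.absNorm := by
  have h0 : P.absNorm ≠ 0 := fun h => hP.ne_zero (Ideal.absNorm_eq_zero_iff.1 h)
  have h1 : P.absNorm ≠ 1 := fun h =>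
    hP.not_isUnit (Ideal.isUnit_iff.2 (Ideal.absNorm_eq_one_iff.1 h))
  omega

theorem finite_primePowerPairs (Y : ℕ) :
    {q : Ideal O × ℕ | Prime q.1 ∧ 1 ≤ q.2 ∧ q.1.absNorm ^ q.2 ≤ Y}.Finite := by
  refine ((Ideal.finite_setOfPred_absNorm_le (S := O) Y).prod (Set.finite_Iic Y)).subset ?_
  rintro ⟨P, k⟩ ⟨hP, hk, hY⟩
  have h2 := two_le_absNorm_of_prime hP
  refine ⟨(Nat.le_self_pow (by omega) _).trans hY, ?_⟩
  exact ((Nat.lt_two_pow_self).le.trans (Nat.pow_le_pow_left h2 k)).trans hY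

/-- The pairs `(P, k)` of a nonzero prime ideal `P` and `k ≥ 1` such that `P ^ k` has norm at most
`Y`. -/
noncomputable def primePowerPairs (Y : ℕ) : Finset (Ideal O × ℕ) :=
  (finite_primePowerPairs O Y).toFinset

variable {O} in
theorem mem_primePowerPairs {Y : ℕ} {q : Ideal O × ℕ} :
    q ∈ primePowerPairs O Y ↔ Prime q.1 ∧ 1 ≤ q.2 ∧ q.1.absNorm ^ q.2 ≤ Y := by
  simp [primePowerPairs]

open Classical in
theorem sum_log_absNorm {J : Ideal O} (hJ : J ≠ ⊥) {Y : ℕ} (hY : J.absNorm ≤ Y) :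
    ∑ q ∈ (primePowerPairs O Y).filter (fun q => J ≤ q.1 ^ q.2), Real.log q.1.absNorm =
      Real.log J.absNorm := by
  have hJ0 : J.absNorm ≠ 0 := fun h => hJ (Ideal.absNorm_eq_zero_iff.1 h)
  have hdvd : ∀ P : Ideal O, Prime P → ∀ k : ℕ,
      J ≤ P ^ k ↔ k ≤ (normalizedFactors J).count P := by
    intro P hP k
    rw [← Ideal.dvd_iff_le, pow_dvd_iff_le_emultiplicity,
      emultiplicity_eq_count_normalizedFactors hP.irreducible hJ, normalize_eq]
    exact Nat.cast_le
  have h1 : Real.log J.absNorm =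
      ∑ P ∈ (normalizedFactors J).toFinset,
        ∑ k ∈ Finset.Icc 1 ((normalizedFactors J).count P), Real.log P.absNorm := by
    have h2 : ((normalizedFactors J).map (fun P => P.absNorm)).prod = J.absNorm := by
      conv_rhs => rw [← Ideal.prod_normalizedFactors_eq_self hJ]
      exact (map_multiset_prod Ideal.absNorm _).symm
    rw [← h2]
    rw [Finset.prod_multiset_map_count, Nat.cast_prod, Real.log_prod]
    · refine Finset.sum_congr rfl fun P _ => ?_
      simp
    · intro P hP
      have := two_le_absNorm_of_prime (prime_of_normalized_factor P (Multiset.mem_toFinset.1 hP))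
      positivity
  rw [h1, Finset.sum_sigma']
  symm
  refine Finset.sum_nbij (fun x => (x.1, x.2)) ?_ ?_ ?_ ?_
  · rintro ⟨P, k⟩ h
    simp only [Finset.mem_sigma, Multiset.mem_toFinset, Finset.mem_Icc] at h
    have hP := prime_of_normalized_factor P h.1
    have hle := (hdvd P hP k).2 h.2.2
    refine Finset.mem_filter.2 ⟨mem_primePowerPairs.2 ⟨hP, h.2.1, ?_⟩, hle⟩
    refine le_trans ?_ hY
    rw [← map_pow]
    exact Nat.le_of_dvd (Nat.pos_of_ne_zero hJ0) (Ideal.absNorm_dvd_absNorm_of_le hle)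
  · rintro ⟨P, k⟩ _ ⟨P', k'⟩ _ h
    simp only [Prod.mk.injEq] at h
    obtain ⟨rfl, rfl⟩ := h
    rfl
  · rintro ⟨P, k⟩ h
    simp only [Finset.coe_filter, Set.mem_ofPred_eq, mem_primePowerPairs] at h
    obtain ⟨⟨hP, hk, -⟩, hle⟩ := h
    have hc := (hdvd P hP k).1 hle
    refine ⟨⟨P, k⟩, ?_, rfl⟩
    simp only [Finset.coe_sigma, Set.mem_sigma_iff, Finset.mem_coe, Multiset.mem_toFinset,
      Finset.mem_Icc]
    exact ⟨Multiset.count_pos.1 (by omega), hk, hc⟩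
  · rintro ⟨P, k⟩ _
    rfl

open Classical in
theorem sum_log_absNorm_le {J : Ideal O} (hJ : J ≠ ⊥) (Y : ℕ) :
    ∑ q ∈ (primePowerPairs O Y).filter (fun q => J ≤ q.1 ^ q.2), Real.log q.1.absNorm ≤
      Real.log J.absNorm := by
  rw [← sum_log_absNorm O hJ (le_max_right Y _)]
  refine Finset.sum_le_sum_of_subset_of_nonneg (Finset.filter_subset_filter _ fun q hq => ?_)
    fun q _ _ => Real.log_natCast_nonneg _
  rw [mem_primePowerPairs] at hq ⊢
  exact ⟨hq.1, hq.2.1, hq.2.2.trans (le_max_left _ _)⟩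

/-- The analogue of the von Mangoldt function for ideals, summed over ideals of norm `n`. -/
noncomputable def normVonMangoldt (n : ℕ) : ℝ :=
  ∑ q ∈ (primePowerPairs O n).filter (fun q => q.1.absNorm ^ q.2 = n), Real.log q.1.absNorm

theorem sum_primePowerPairs (Y : ℕ) (g : ℕ → ℝ) :
    ∑ q ∈ primePowerPairs O Y, Real.log q.1.absNorm * g (q.1.absNorm ^ q.2) =
      ∑ n ∈ Finset.range (Y + 1), normVonMangoldt O n * g n := by
  rw [← Finset.sum_fiberwise_of_maps_to (t := Finset.range (Y + 1))
    (g := fun q : Ideal O × ℕ => q.1.absNorm ^ q.2)]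
  · refine Finset.sum_congr rfl fun n hn => ?_
    rw [normVonMangoldt, Finset.sum_mul]
    have : (primePowerPairs O Y).filter (fun q => q.1.absNorm ^ q.2 = n) =
        (primePowerPairs O n).filter (fun q => q.1.absNorm ^ q.2 = n) := by
      ext q
      simp only [Finset.mem_filter, mem_primePowerPairs, Finset.mem_range] at hn ⊢
      constructor
      · rintro ⟨⟨h1, h2, h3⟩, h4⟩
        exact ⟨⟨h1, h2, h4.le⟩, h4⟩
      · rintro ⟨⟨h1, h2, h3⟩, h4⟩
        exact ⟨⟨h1, h2, by omega⟩, h4⟩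
    rw [this]
    refine Finset.sum_congr rfl fun q hq => ?_
    rw [(Finset.mem_filter.1 hq).2]
  · intro q hq
    rw [Finset.mem_range]
    have := (mem_primePowerPairs.1 hq).2.2
    omega

theorem normVonMangoldt_le (n : ℕ) :
    normVonMangoldt O n ≤ Module.finrank ℤ O * ArithmeticFunction.vonMangoldt n := by
  classical
  set S := (primePowerPairs O n).filter (fun q => q.1.absNorm ^ q.2 = n) with hS
  rcases S.eq_empty_or_nonempty with h | ⟨⟨P, k⟩, hq⟩
  · rw [normVonMangoldt, ← hS, h, Finset.sum_empty]
    exact mul_nonneg (Nat.cast_nonneg _) ArithmeticFunction.vonMangoldt_nonneg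
  simp only [hS, Finset.mem_filter, mem_primePowerPairs] at hq
  obtain ⟨⟨hP, hk, -⟩, hn⟩ := hq
  have hnorm : ∀ p : ℕ, (Ideal.span {(p : O)}).absNorm = p ^ Module.finrank ℤ O := by
    intro p
    rw [Ideal.absNorm_span_singleton]
    have : ((p : ℤ) : O) = algebraMap ℤ O p := by simp
    have h2 : (p : O) = algebraMap ℤ O p := by simp
    rw [h2, Algebra.norm_algebraMap, Int.natAbs_pow, Int.natAbs_natCast]
  have key : ∀ Q : Ideal O, Prime Q → ∀ p : ℕ, p.Prime → (p : O) ∈ Q →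
      ∃ i, 1 ≤ i ∧ Q.absNorm = p ^ i := by
    intro Q hQ p hp hpQ
    have h1 : Q.absNorm ∣ p ^ Module.finrank ℤ O := by
      rw [← hnorm]
      exact Ideal.absNorm_dvd_absNorm_of_le ((Ideal.span_singleton_le_iff_mem _).2 hpQ)
    obtain ⟨i, -, hi⟩ := (Nat.dvd_prime_pow hp).1 h1
    refine ⟨i, ?_, hi⟩
    rcases Nat.eq_zero_or_pos i with rfl | h
    · have := two_le_absNorm_of_prime hQ
      simp [hi] at this
    · exact h
  have hmem : ∀ Q : Ideal O, Prime Q → ∀ (p : ℕ), p.Prime → ∀ i j, 1 ≤ j → Q.absNorm ^ j = p ^ i →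
      (p : O) ∈ Q := by
    intro Q hQ p hp i j hj h
    have h1 : ((Q.absNorm : O)) ^ j ∈ Q := Ideal.pow_mem_of_mem _ (Ideal.absNorm_mem Q) _ (by omega)
    rw [← Nat.cast_pow, h, Nat.cast_pow] at h1
    exact ((Ideal.prime_iff_isPrime hQ.ne_zero).1 hQ).mem_of_pow_mem _ h1
  obtain ⟨p, hp, hpP⟩ : ∃ p : ℕ, p.Prime ∧ (p : O) ∈ P := by
    have hPp := (Ideal.prime_iff_isPrime hP.ne_zero).1 hP
    have h1 : ((P.absNorm : ℕ) : O) ∈ P := Ideal.absNorm_mem P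
    have h2 := two_le_absNorm_of_prime hP
    rw [← Nat.prod_primeFactorsList (show P.absNorm ≠ 0 by omega), Nat.cast_list_prod,
      ← Multiset.prod_coe] at h1
    obtain ⟨x, hx, hxP⟩ := (Ideal.IsPrime.multiset_prod_mem_iff_exists_mem hPp _).1 h1
    obtain ⟨p, hp, rfl⟩ := List.mem_map.1 (Multiset.mem_coe.1 hx)
    exact ⟨p, Nat.prime_of_mem_primeFactorsList hp, hxP⟩
  obtain ⟨i, hi, hPi⟩ := key P hP p hp hpP
  have hnp : n = p ^ (i * k) := by rw [← hn, hPi, pow_mul]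
  have hik : i * k ≠ 0 := by positivity
  have hspan : Ideal.span {(p : O)} ≠ ⊥ := by
    rw [Ne, Ideal.span_singleton_eq_bot]
    exact_mod_cast hp.ne_zero
  rw [hnp, ArithmeticFunction.vonMangoldt_apply_pow hik,
    ArithmeticFunction.vonMangoldt_apply_prime hp,
    ← Real.log_pow, ← hnp]
  have hc : ((p : ℝ)) ^ Module.finrank ℤ O = ((Ideal.span {(p : O)}).absNorm : ℝ) := by
    rw [hnorm]
    push_cast
    rfl
  rw [hc, ← sum_log_absNorm O hspan le_rfl, normVonMangoldt, ← hS]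
  have hinj : ∀ q ∈ S, Prime q.1 ∧ 1 ≤ q.2 ∧ (p : O) ∈ q.1 ∧ q.1.absNorm ^ q.2 = n := by
    intro q hq
    simp only [hS, Finset.mem_filter, mem_primePowerPairs] at hq
    exact ⟨hq.1.1, hq.1.2.1, hmem q.1 hq.1.1 p hp _ _ hq.1.2.1 (hq.2.trans hnp), hq.2⟩
  have hI : Set.InjOn (fun q : Ideal O × ℕ => (q.1, 1)) S := by
    rintro ⟨Q, j⟩ hq ⟨Q', j'⟩ hq' h
    simp only [Prod.mk.injEq, and_true] at h
    subst h
    have h1 := (hinj _ hq)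
    have h2 := (hinj _ hq')
    have := Nat.pow_right_injective (two_le_absNorm_of_prime h1.1) (h1.2.2.2.trans h2.2.2.2.symm)
    simp only at this
    rw [this]
  rw [← Finset.sum_image (f := fun q : Ideal O × ℕ => Real.log q.1.absNorm) hI]
  refine Finset.sum_le_sum_of_subset_of_nonneg ?_ fun q _ _ => Real.log_natCast_nonneg _
  intro q hq
  obtain ⟨r, hr, rfl⟩ := Finset.mem_image.1 hq
  obtain ⟨h1, h2, h3, h4⟩ := hinj r hr
  have hle : Ideal.span {(p : O)} ≤ r.1 := (Ideal.span_singleton_le_iff_mem _).2 h3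
  refine Finset.mem_filter.2 ⟨mem_primePowerPairs.2 ⟨h1, le_rfl, ?_⟩, ?_⟩
  · rw [pow_one]
    exact Nat.le_of_dvd (Nat.pos_of_ne_zero fun h => hspan (Ideal.absNorm_eq_zero_iff.1 h))
      (Ideal.absNorm_dvd_absNorm_of_le hle)
  · simpa using hle

theorem exists_hom_zmod_of_normVonMangoldt_ne_zero {p : ℕ} (hp : p.Prime)
    (h : normVonMangoldt O p ≠ 0) : Nonempty (O →+* ZMod p) := by
  obtain ⟨⟨P, k⟩, hq, -⟩ := Finset.exists_ne_zero_of_sum_ne_zero h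
  simp only [Finset.mem_filter, mem_primePowerPairs] at hq
  have hP : P.absNorm = p := by
    have : k = 1 := by
      by_contra hk
      exact (Nat.Prime.not_prime_pow (x := P.absNorm) (n := k) (by omega)) (hq.2 ▸ hp)
    simpa [this] using hq.2
  have hne : P ≠ ⊥ := hq.1.1.ne_zero
  have hfin : Finite (O ⧸ P) := Ideal.finiteQuotientOfFreeOfNeBot P hne
  have := Fintype.ofFinite (O ⧸ P)
  have hcard : Fintype.card (O ⧸ P) = p := by
    rw [← hP, Ideal.absNorm_apply, Submodule.cardQuot_apply, Nat.card_eq_fintype_card]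
  exact ⟨(ZMod.ringEquivOfPrime (O ⧸ P) hp hcard).symm.toRingHom.comp (Ideal.Quotient.mk P)⟩

end IdealVonMangoldt

section Scale

/-- A power of two whose `m`-th power exceeds `n`, by a factor of at most `2 ^ m`. -/
def dyadicRoot (m n : ℕ) : ℕ := 2 ^ (Nat.log 2 n / m + 1)

theorem lt_dyadicRoot_pow {m : ℕ} (hm : 0 < m) (n : ℕ) : n < dyadicRoot m n ^ m := by
  rw [dyadicRoot, ← pow_mul]
  refine (Nat.lt_pow_succ_log_self one_lt_two n).trans_le (Nat.pow_le_pow_right two_pos ?_)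
  have := Nat.div_add_mod (Nat.log 2 n) m
  have h2 := Nat.mod_lt (Nat.log 2 n) hm
  nlinarith

theorem dyadicRoot_le {m n J : ℕ} (hm : 0 < m) (hn : n < 2 ^ (m * J)) (hJ : 0 < J) :
    dyadicRoot m n ≤ 2 ^ J := by
  refine Nat.pow_le_pow_right two_pos ?_
  have h1 : Nat.log 2 n < m * J := by
    rcases Nat.eq_zero_or_pos n with rfl | h
    · simpa using ⟨hm, hJ⟩
    · exact Nat.log_lt_of_lt_pow h.ne' hn
  exact Nat.div_lt_of_lt_mul h1

theorem exists_sum_mul_dyadicRoot_le {m : ℕ} (hm : 0 < m) {a : ℕ → ℝ} {M : ℝ} (hM : 0 ≤ M)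
    (haM : ∀ n, a n ≤ M * ArithmeticFunction.vonMangoldt n) :
    ∃ C, 0 ≤ C ∧ ∀ J, ∑ n ∈ Finset.range (2 ^ (m * J)), a n * (dyadicRoot m n / n) ≤ C * 2 ^ J := by
  have hlog : 0 ≤ Real.log 4 + 4 := add_nonneg (Real.log_nonneg (by norm_num)) (by norm_num)
  refine ⟨2 ^ (m + 1) * (M * (Real.log 4 + 4)), by positivity, fun J => ?_⟩
  induction J with
  | zero => simpa using by positivity
  | succ J ih =>
    have hle : 2 ^ (m * J) ≤ 2 ^ (m * (J + 1)) :=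
      Nat.pow_le_pow_right two_pos (Nat.mul_le_mul_left m (Nat.le_succ J))
    rw [← Finset.sum_range_add_sum_Ico _ hle]
    have hblock : ∑ n ∈ Finset.Ico (2 ^ (m * J)) (2 ^ (m * (J + 1))), a n * (dyadicRoot m n / n) ≤
        2 ^ (m + 1) * (M * (Real.log 4 + 4)) * 2 ^ J := by
      calc _ ≤ ∑ n ∈ Finset.Ico (2 ^ (m * J)) (2 ^ (m * (J + 1))),
            M * ArithmeticFunction.vonMangoldt n * (2 ^ (J + 1) / 2 ^ (m * J)) := by
            refine Finset.sum_le_sum fun n hn => ?_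
            rw [Finset.mem_Ico] at hn
            have h1 : ((2 : ℝ) ^ (m * J)) ≤ n := by exact_mod_cast hn.1
            have h2 : (dyadicRoot m n : ℝ) ≤ 2 ^ (J + 1) := by
              exact_mod_cast dyadicRoot_le hm hn.2 J.succ_pos
            gcongr
            exact haM n
        _ ≤ (M * Chebyshev.psi (2 ^ (m * (J + 1)) : ℕ)) * (2 ^ (J + 1) / 2 ^ (m * J)) := by
            rw [← Finset.sum_mul, ← Finset.mul_sum]
            gcongr
            rw [Chebyshev.psi, Nat.floor_natCast]
            refine Finset.sum_le_sum_of_subset_of_nonneg ?_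
              fun n _ _ => ArithmeticFunction.vonMangoldt_nonneg
            intro n hn
            rw [Finset.mem_Ico] at hn
            rw [Finset.mem_Ioc]
            exact ⟨lt_of_lt_of_le (by positivity) hn.1, hn.2.le⟩
        _ ≤ (M * ((Real.log 4 + 4) * (2 ^ (m * (J + 1)) : ℕ))) * (2 ^ (J + 1) / 2 ^ (m * J)) := by
            gcongr
            exact Chebyshev.psi_le_const_mul_self (Nat.cast_nonneg _)
        _ = _ := by
            push_cast
            rw [mul_add, pow_add]
            field_simp
            ring
    calc _ ≤ _ := add_le_add ih hblock
      _ = _ := by ring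

theorem one_add_pow_le {u U : ℝ} (hu : 0 ≤ u) (huU : u ≤ U) (m : ℕ) :
    (1 + u) ^ m ≤ 1 + u * (m * (1 + U) ^ m) := by
  induction m with
  | zero => simp
  | succ m ih =>
    have hU : 0 ≤ 1 + U := by linarith
    have h1 : 1 ≤ (1 + U) ^ (m + 1) := one_le_pow₀ (by linarith)
    calc (1 + u) ^ (m + 1) = (1 + u) ^ m * (1 + u) := pow_succ _ _
      _ ≤ (1 + u * (m * (1 + U) ^ m)) * (1 + u) := by gcongr
      _ = 1 + u * 1 + u * (m * ((1 + U) ^ m * (1 + u))) := by ring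
      _ ≤ 1 + u * (1 + U) ^ (m + 1) + u * (m * ((1 + U) ^ m * (1 + U))) := by gcongr
      _ = _ := by push_cast; ring

end Scale

section RealBoxCount

variable {O ι : Type*} [CommRing O] [Fintype ι] (b : Module.Basis ι ℤ O)
  [IsDedekindDomain O] [Module.Free ℤ O] [Module.Finite ℤ O]

theorem exists_boxCount_approx (hι : 0 < Fintype.card ι) (R : ℕ) : ∃ D : ℝ, 0 ≤ D ∧
    ∀ I : Ideal O, I ≠ ⊥ → ∀ (t : O) (H : ℕ), 0 < H →
      (H : ℝ) ^ Fintype.card ι * (1 / I.absNorm -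
        D / H * (dyadicRoot (Fintype.card ι) I.absNorm / I.absNorm)) ≤ boxCount b I t H ∧
      (dyadicRoot (Fintype.card ι) I.absNorm ≤ R * H →
        (boxCount b I t H : ℝ) ≤ (H : ℝ) ^ Fintype.card ι * (1 / I.absNorm +
          D / H * (dyadicRoot (Fintype.card ι) I.absNorm / I.absNorm))) := by
  obtain ⟨C, hC⟩ := exists_boxCount_bounds b
  set m := Fintype.card ι with hm
  have hU : (0 : ℝ) ≤ (C * R : ℝ) := by positivity
  refine ⟨C * (m * (1 + C * R) ^ m), by positivity, fun I hI t H hH => ?_⟩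
  set N := I.absNorm with hN
  have hN0 : N ≠ 0 := by rwa [hN, Ne, Ideal.absNorm_eq_zero_iff]
  have hN1 : (0 : ℝ) < N := by positivity
  set s := dyadicRoot m N with hs
  have hlt : N < (s + 1) ^ m := (lt_dyadicRoot_pow hι N).trans_le
    (Nat.pow_le_pow_left (Nat.le_succ _) m)
  have hH' : (0 : ℝ) < H := by positivity
  constructor
  · have hge : (m : ℝ) * C ≤ C * (m * (1 + C * R) ^ m) := by
      have : (1 : ℝ) ≤ (1 + C * R) ^ m := one_le_pow₀ (by linarith)
      calc (m : ℝ) * C = C * (m * 1) := by ring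
        _ ≤ _ := by gcongr
    have hle : (H : ℝ) ^ m * (1 / N - C * (m * (1 + C * R) ^ m) / H * (s / N)) ≤
        (H : ℝ) ^ m * (1 / N - m * C / H * (s / N)) := by gcongr
    refine hle.trans ?_
    rcases le_or_gt (C * s) H with h | h
    · obtain ⟨H', rfl⟩ := Nat.exists_eq_add_of_le' h
      have h1 := (hC I hI s hlt t H').1
      have h2 : (H' : ℝ) ^ m ≤ N * boxCount b I t (H' + C * s) := by exact_mod_cast h1
      set H := H' + C * s with hHH
      have h3 : (H' : ℝ) = H * (1 + -(C * s / H)) := by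
        field_simp
        rw [hHH]
        push_cast
        ring
      have h4 : (C * s / H : ℝ) ≤ 1 := by
        rw [div_le_one hH']
        exact_mod_cast h
      have h5 := one_add_mul_le_pow (a := (-(C * s / H) : ℝ)) (by linarith) m
      rw [h3, mul_pow] at h2
      have h6 : (H : ℝ) ^ m * (1 + m * -(C * s / H)) ≤ N * boxCount b I t H :=
        (mul_le_mul_of_nonneg_left h5 (by positivity)).trans h2
      calc (H : ℝ) ^ m * (1 / N - m * C / H * (s / N)) =
            ((H : ℝ) ^ m * (1 + m * -(C * s / H))) / N := by field_simp; ring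
        _ ≤ _ := by
            rw [div_le_iff₀ hN1, mul_comm _ (N : ℝ)]
            exact h6
    · have h4 : (1 : ℝ) ≤ C * s / H := by
        rw [one_le_div hH']
        exact_mod_cast h.le
      have h5 : (1 : ℝ) ≤ m := by exact_mod_cast hι
      have h6 : (1 : ℝ) / N - m * C / H * (s / N) ≤ 0 := by
        have : (1 : ℝ) / N - m * C / H * (s / N) = (1 - m * (C * s / H)) / N := by field_simp
        rw [this]
        apply div_nonpos_of_nonpos_of_nonneg _ hN1.le
        nlinarith
      exact (mul_nonpos_of_nonneg_of_nonpos (by positivity) h6).trans (Nat.cast_nonneg _)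
  · intro hsR
    have h1 := (hC I hI s hlt t H).2
    have h2 : (N : ℝ) * boxCount b I t H ≤ (H + C * s : ℝ) ^ m := by exact_mod_cast h1
    have h3 : (H + C * s : ℝ) = H * (1 + C * s / H) := by field_simp
    have h4 : (C * s / H : ℝ) ≤ C * R := by
      rw [div_le_iff₀ hH', mul_assoc]
      gcongr
      exact_mod_cast hsR
    have h5 := one_add_pow_le (by positivity) h4 m
    rw [h3, mul_pow] at h2
    have h6 := h2.trans (mul_le_mul_of_nonneg_left h5 (by positivity))
    calc (boxCount b I t H : ℝ) ≤
        ((H : ℝ) ^ m * (1 + (C * s / H) * (m * (1 + C * R) ^ m))) / N := by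
          rw [le_div_iff₀ hN1, mul_comm]
          exact h6
      _ = _ := by field_simp

open Classical in
theorem sum_log_mul_boxCount [CharZero O] (t : O) (H Y : ℕ) :
    ∑ q ∈ primePowerPairs O Y, Real.log q.1.absNorm * boxCount b (q.1 ^ q.2) t H =
      ∑ v ∈ Fintype.piFinset fun _ : ι => Finset.range H,
        ∑ q ∈ (primePowerPairs O Y).filter
          (fun q => Ideal.span {t + natComb b v} ≤ q.1 ^ q.2), Real.log q.1.absNorm := by
  simp_rw [Finset.sum_filter]
  rw [Finset.sum_comm]
  refine Finset.sum_congr rfl fun q _ => ?_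
  rw [boxCount, Finset.card_filter, Nat.cast_sum, Finset.mul_sum]
  refine Finset.sum_congr rfl fun v _ => ?_
  simp only [Ideal.span_singleton_le_iff_mem]
  split_ifs <;> simp

end RealBoxCount

section NumberFieldChebyshev

open NumberField

variable (K : Type*) [Field K] [NumberField K]

theorem absNorm_span_singleton_eq_prod (x : 𝓞 K) :
    ((Ideal.span {x}).absNorm : ℝ) = ∏ σ : K →ₐ[ℚ] ℂ, ‖σ x‖ := by
  rw [Ideal.absNorm_span_singleton, ← norm_prod, ← Algebra.norm_eq_prod_embeddings ℚ ℂ (x : K),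
    ← Algebra.coe_norm_int]
  simp [Nat.cast_natAbs]

theorem exists_box_absNorm_bounds {ι : Type*} [Fintype ι] (b : Module.Basis ι ℤ (𝓞 K)) :
    ∃ T C : ℕ, ∀ (H : ℕ) (v : ι → ℕ), (∀ i, v i < H) →
      H ^ Module.finrank ℚ K ≤ (Ideal.span {((T * H : ℕ) : 𝓞 K) + natComb b v}).absNorm ∧
      (Ideal.span {((T * H : ℕ) : 𝓞 K) + natComb b v}).absNorm ≤ (C * H) ^ Module.finrank ℚ K := by
  classical
  obtain ⟨C₁, hC₁⟩ := exists_nat_ge (∑ σ : K →ₐ[ℚ] ℂ, ∑ i, ‖σ (b i)‖)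
  refine ⟨C₁ + 1, 2 * C₁ + 1, fun H v hv => ?_⟩
  have hcomb : ∀ σ : K →ₐ[ℚ] ℂ, ‖σ (natComb b v : 𝓞 K)‖ ≤ C₁ * H := by
    intro σ
    have h1 : σ (natComb b v : 𝓞 K) = ∑ i, (v i : ℂ) * σ (b i) := by
      simp [natComb]
    rw [h1]
    calc ‖∑ i, (v i : ℂ) * σ (b i)‖ ≤ ∑ i, ‖(v i : ℂ) * σ (b i)‖ := norm_sum_le _ _
      _ ≤ ∑ i, H * ‖σ (b i)‖ := by
        refine Finset.sum_le_sum fun i _ => ?_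
        rw [norm_mul, Complex.norm_natCast]
        gcongr
        exact (hv i).le
      _ = (∑ i, ‖σ (b i)‖) * H := by rw [← Finset.mul_sum, mul_comm]
      _ ≤ _ := by
        gcongr
        exact (Finset.single_le_sum (f := fun σ : K →ₐ[ℚ] ℂ => ∑ i, ‖σ (b i)‖)
          (fun σ _ => by positivity) (Finset.mem_univ σ)).trans hC₁
  have hval : ∀ σ : K →ₐ[ℚ] ℂ, σ (((((C₁ + 1) * H : ℕ) : 𝓞 K) + natComb b v : 𝓞 K) : K) =
      (((C₁ + 1) * H : ℕ) : ℂ) + σ (natComb b v : 𝓞 K) := by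
    intro σ
    rw [RingOfIntegers.coe_eq_algebraMap, RingOfIntegers.coe_eq_algebraMap, map_add, map_add,
      map_natCast, map_natCast]
  have hcard : Module.finrank ℚ K = (Finset.univ : Finset (K →ₐ[ℚ] ℂ)).card := by
    rw [Finset.card_univ, AlgHom.card ℚ K ℂ]
  have hT : ‖(((C₁ + 1) * H : ℕ) : ℂ)‖ = (C₁ + 1) * H := by
    rw [Complex.norm_natCast]
    push_cast
    rfl
  constructor
  · have : ((H ^ Module.finrank ℚ K : ℕ) : ℝ) ≤
        ((Ideal.span {((((C₁ + 1) * H : ℕ) : 𝓞 K) + natComb b v)}).absNorm : ℝ) := by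
      rw [absNorm_span_singleton_eq_prod, hcard, Nat.cast_pow, ← Finset.prod_const]
      refine Finset.prod_le_prod (fun _ _ => Nat.cast_nonneg _) fun σ _ => ?_
      rw [hval]
      have h1 := norm_sub_le_norm_add (((C₁ + 1) * H : ℕ) : ℂ) (σ (natComb b v : 𝓞 K))
      have h2 := hcomb σ
      rw [hT] at h1
      linarith
    exact_mod_cast this
  · have : ((Ideal.span {((((C₁ + 1) * H : ℕ) : 𝓞 K) + natComb b v)}).absNorm : ℝ) ≤
        (((((2 * C₁ + 1) * H) ^ Module.finrank ℚ K : ℕ)) : ℝ) := by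
      rw [absNorm_span_singleton_eq_prod, hcard, Nat.cast_pow, ← Finset.prod_const]
      refine Finset.prod_le_prod (fun _ _ => norm_nonneg _) fun σ _ => ?_
      rw [hval]
      have h1 := norm_add_le (((C₁ + 1) * H : ℕ) : ℂ) (σ (natComb b v : 𝓞 K))
      have h2 := hcomb σ
      rw [hT] at h1
      push_cast at h1 ⊢
      linarith
    exact_mod_cast this

theorem exists_sum_normVonMangoldt_bounds : ∃ B : ℝ, ∃ c : ℕ, ∀ h : ℕ,
    ∑ n ∈ Finset.range (2 ^ (Module.finrank ℚ K * h)), normVonMangoldt (𝓞 K) n / n ≤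
      Module.finrank ℚ K * h * Real.log 2 + B ∧
    Module.finrank ℚ K * h * Real.log 2 - B ≤
      ∑ n ∈ Finset.range (2 ^ (Module.finrank ℚ K * (h + c))), normVonMangoldt (𝓞 K) n / n := by
  classical
  set b := RingOfIntegers.basis K
  set m := Module.finrank ℚ K with hm
  have hm0 : 0 < m := Module.finrank_pos
  have hcard : Fintype.card (Module.Free.ChooseBasisIndex ℤ (𝓞 K)) = m := by
    rw [← Module.finrank_eq_card_chooseBasisIndex, RingOfIntegers.rank]
  obtain ⟨T, C, hTC⟩ := exists_box_absNorm_bounds K b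
  obtain ⟨c, hc⟩ := pow_unbounded_of_one_lt C one_lt_two
  obtain ⟨D, hD0, hD⟩ := exists_boxCount_approx b (hcard.symm ▸ hm0) (2 ^ (c + 1))
  obtain ⟨E, hE0, hE⟩ := exists_sum_mul_dyadicRoot_le hm0 (M := m) (Nat.cast_nonneg m)
    (a := normVonMangoldt (𝓞 K)) (fun n => by
      have := normVonMangoldt_le (𝓞 K) n
      rwa [RingOfIntegers.rank] at this)
  rw [hcard] at hD
  set box : ℕ → Finset (Module.Free.ChooseBasisIndex ℤ (𝓞 K) → ℕ) := fun H =>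
    Fintype.piFinset fun _ => Finset.range H with hbox
  have hboxcard : ∀ H, ((box H).card : ℝ) = (H : ℝ) ^ m := by
    intro H
    simp [hbox, hcard]
  have hne : ∀ H v, 0 < H → v ∈ box H →
      Ideal.span {((T * H : ℕ) : 𝓞 K) + natComb b v} ≠ ⊥ := by
    intro H v hH hv h0
    have h1 := (hTC H v (by simpa [hbox] using hv)).1
    rw [h0, Ideal.absNorm_bot] at h1
    have : 0 < H ^ m := by positivity
    exact absurd h1 (not_le.2 this)
  have hpow : ∀ q : Ideal (𝓞 K) × ℕ, Prime q.1 → q.1 ^ q.2 ≠ ⊥ := fun q hq =>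
    pow_ne_zero _ hq.ne_zero
  refine ⟨D * E + |Real.log ((C + 1) ^ m)| + D * E * 2 ^ c, c, fun h => ⟨?_, ?_⟩⟩
  · set H := 2 ^ h with hH
    have hHpos : 0 < H := by positivity
    have hrange : 2 ^ (m * h) - 1 + 1 = 2 ^ (m * h) := Nat.sub_add_cancel Nat.one_le_two_pow
    have h1 : ∑ v ∈ box H, ∑ q ∈ (primePowerPairs (𝓞 K) (2 ^ (m * h) - 1)).filter
          (fun q => Ideal.span {((T * H : ℕ) : 𝓞 K) + natComb b v} ≤ q.1 ^ q.2),
          Real.log q.1.absNorm ≤ (H : ℝ) ^ m * (m * h * Real.log 2 + Real.log ((C + 1) ^ m)) := by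
      rw [← hboxcard, ← nsmul_eq_mul]
      refine Finset.sum_le_card_nsmul _ _ _ fun v hv => ?_
      refine (sum_log_absNorm_le (𝓞 K) (hne H v hHpos hv) _).trans ?_
      have h2 := hTC H v (by simpa [hbox] using hv)
      have h3 : (0 : ℝ) < (Ideal.span {((T * H : ℕ) : 𝓞 K) + natComb b v}).absNorm := by
        have : 0 < H ^ m := by positivity
        exact_mod_cast this.trans_le h2.1
      have h4 : ((Ideal.span {((T * H : ℕ) : 𝓞 K) + natComb b v}).absNorm : ℝ) ≤
          2 ^ (m * h) * (C + 1) ^ m := by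
        have h5 : ((C * H) ^ m : ℕ) ≤ 2 ^ (m * h) * (C + 1) ^ m := by
          rw [hH, mul_comm m h, pow_mul, ← mul_pow, mul_comm C]
          gcongr
          omega
        exact_mod_cast h2.2.trans h5
      refine (Real.log_le_log h3 h4).trans (le_of_eq ?_)
      rw [Real.log_mul (by positivity) (by positivity), Real.log_pow]
      push_cast
      ring
    rw [← sum_log_mul_boxCount] at h1
    have h2 : ∑ q ∈ primePowerPairs (𝓞 K) (2 ^ (m * h) - 1), Real.log q.1.absNorm *
        ((H : ℝ) ^ m * (1 / (q.1.absNorm ^ q.2 : ℕ) - D / H * (dyadicRoot m (q.1.absNorm ^ q.2) /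
          (q.1.absNorm ^ q.2 : ℕ)))) ≤
          (H : ℝ) ^ m * (m * h * Real.log 2 + Real.log ((C + 1) ^ m)) := by
      refine le_trans (Finset.sum_le_sum fun q hq => ?_) h1
      refine mul_le_mul_of_nonneg_left ?_ (Real.log_natCast_nonneg _)
      have := (hD (q.1 ^ q.2) (hpow q (mem_primePowerPairs.1 hq).1) ((T * H : ℕ) : 𝓞 K) H hHpos).1
      rwa [map_pow] at this
    rw [sum_primePowerPairs (𝓞 K) _ (fun n => (H : ℝ) ^ m * (1 / (n : ℝ) -
      D / H * (dyadicRoot m n / (n : ℝ)))), hrange] at h2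
    have h3 : ∑ n ∈ Finset.range (2 ^ (m * h)), normVonMangoldt (𝓞 K) n *
        ((H : ℝ) ^ m * (1 / (n : ℝ) - D / H * (dyadicRoot m n / (n : ℝ)))) =
        (H : ℝ) ^ m * (∑ n ∈ Finset.range (2 ^ (m * h)), normVonMangoldt (𝓞 K) n / n -
          D / H * ∑ n ∈ Finset.range (2 ^ (m * h)),
            normVonMangoldt (𝓞 K) n * (dyadicRoot m n / n)) := by
      rw [Finset.mul_sum, ← Finset.sum_sub_distrib, Finset.mul_sum]
      refine Finset.sum_congr rfl fun n _ => ?_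
      ring
    rw [h3] at h2
    have h4 := le_of_mul_le_mul_left h2 (by positivity)
    have h5 : D / H * ∑ n ∈ Finset.range (2 ^ (m * h)),
        normVonMangoldt (𝓞 K) n * (dyadicRoot m n / n) ≤ D / H * (E * H) := by
      gcongr
      exact (hE h).trans (by rw [hH]; push_cast; rfl)
    have h6 : D / H * (E * H) = D * E := by field_simp
    have h7 := le_abs_self (Real.log ((C + 1) ^ m))
    have h8 : 0 ≤ D * E * 2 ^ c := by positivity
    linarith
  · set H := 2 ^ h with hH
    have hHpos : 0 < H := by positivity
    have hrange : 2 ^ (m * (h + c)) - 1 + 1 = 2 ^ (m * (h + c)) :=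
      Nat.sub_add_cancel Nat.one_le_two_pow
    have h1 : (H : ℝ) ^ m * (m * h * Real.log 2) ≤
        ∑ v ∈ box H, ∑ q ∈ (primePowerPairs (𝓞 K) (2 ^ (m * (h + c)) - 1)).filter
          (fun q => Ideal.span {((T * H : ℕ) : 𝓞 K) + natComb b v} ≤ q.1 ^ q.2),
          Real.log q.1.absNorm := by
      rw [← hboxcard, ← nsmul_eq_mul]
      refine Finset.card_nsmul_le_sum _ _ _ fun v hv => ?_
      have h2 := hTC H v (by simpa [hbox] using hv)
      rw [sum_log_absNorm (𝓞 K) (hne H v hHpos hv)]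
      · have h3 : (2 : ℝ) ^ (m * h) ≤
            (Ideal.span {((T * H : ℕ) : 𝓞 K) + natComb b v}).absNorm := by
          have := h2.1
          rw [hH, ← pow_mul, mul_comm h] at this
          exact_mod_cast this
        refine le_trans (le_of_eq ?_) (Real.log_le_log (by positivity) h3)
        rw [Real.log_pow]
        push_cast
        ring
      · refine Nat.le_sub_one_of_lt (h2.2.trans_lt ?_)
        rw [mul_comm m, pow_mul, pow_add, mul_comm C]
        exact Nat.pow_lt_pow_left (Nat.mul_lt_mul_of_pos_left hc hHpos) hm0.ne'
    rw [← sum_log_mul_boxCount] at h1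
    have h2 : (H : ℝ) ^ m * (m * h * Real.log 2) ≤
        ∑ q ∈ primePowerPairs (𝓞 K) (2 ^ (m * (h + c)) - 1), Real.log q.1.absNorm *
        ((H : ℝ) ^ m * (1 / (q.1.absNorm ^ q.2 : ℕ) + D / H * (dyadicRoot m (q.1.absNorm ^ q.2) /
          (q.1.absNorm ^ q.2 : ℕ)))) := by
      refine le_trans h1 (Finset.sum_le_sum fun q hq => ?_)
      refine mul_le_mul_of_nonneg_left ?_ (Real.log_natCast_nonneg _)
      have hq' := mem_primePowerPairs.1 hq
      have := (hD (q.1 ^ q.2) (hpow q hq'.1) ((T * H : ℕ) : 𝓞 K) H hHpos).2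
      rw [map_pow] at this
      refine this ?_
      rw [hH, ← pow_add]
      refine dyadicRoot_le hm0 (lt_of_le_of_lt hq'.2.2 ?_) (by omega)
      refine (Nat.sub_one_lt_of_le (by positivity) le_rfl).trans_le ?_
      exact Nat.pow_le_pow_right two_pos (Nat.mul_le_mul_left m (by omega))
    rw [sum_primePowerPairs (𝓞 K) _ (fun n => (H : ℝ) ^ m * (1 / (n : ℝ) +
      D / H * (dyadicRoot m n / (n : ℝ)))), hrange] at h2
    have h3 : ∑ n ∈ Finset.range (2 ^ (m * (h + c))), normVonMangoldt (𝓞 K) n *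
        ((H : ℝ) ^ m * (1 / (n : ℝ) + D / H * (dyadicRoot m n / (n : ℝ)))) =
        (H : ℝ) ^ m * (∑ n ∈ Finset.range (2 ^ (m * (h + c))), normVonMangoldt (𝓞 K) n / n +
          D / H * ∑ n ∈ Finset.range (2 ^ (m * (h + c))),
            normVonMangoldt (𝓞 K) n * (dyadicRoot m n / n)) := by
      rw [Finset.mul_sum, ← Finset.sum_add_distrib, Finset.mul_sum]
      refine Finset.sum_congr rfl fun n _ => ?_
      ring
    rw [h3] at h2
    have h4 := le_of_mul_le_mul_left h2 (by positivity)
    have h5 : D / H * ∑ n ∈ Finset.range (2 ^ (m * (h + c))),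
        normVonMangoldt (𝓞 K) n * (dyadicRoot m n / n) ≤ D / H * (E * (2 ^ c * H)) := by
      gcongr
      exact (hE (h + c)).trans (by rw [hH, pow_add, mul_comm (2 ^ h)]; push_cast; rfl)
    have h6 : D / H * (E * (2 ^ c * H)) = D * E * 2 ^ c := by field_simp
    have h7 := abs_nonneg (Real.log ((C + 1) ^ m))
    have h8 : 0 ≤ D * E := by positivity
    linarith

end NumberFieldChebyshev

section SplitPrimes

open NumberField

theorem exists_sum_not_prime_vonMangoldt_le : ∃ C : ℝ, 0 ≤ C ∧ ∀ s : Finset ℕ,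
    ∑ n ∈ s with ¬ n.Prime, ArithmeticFunction.vonMangoldt n / n ≤ C := by
  have h := ArithmeticFunction.vonMangoldt.summable_residueClass_non_primes_div (q := 1) 0
  have heq : ∀ n : ℕ, (if n.Prime then 0 else
      ArithmeticFunction.vonMangoldt.residueClass (0 : ZMod 1) n) / (n : ℝ) =
      if ¬ n.Prime then ArithmeticFunction.vonMangoldt n / (n : ℝ) else 0 := by
    intro n
    have h1 : (n : ZMod 1) = 0 := Subsingleton.elim _ _
    split_ifs with hp
    · simp
    · rw [ArithmeticFunction.vonMangoldt.residueClass, Set.indicator_of_mem]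
      exact h1
  simp_rw [heq] at h
  have hnn : ∀ n : ℕ, 0 ≤ if ¬ n.Prime then ArithmeticFunction.vonMangoldt n / (n : ℝ) else 0 := by
    intro n
    split_ifs
    · exact le_rfl
    · exact div_nonneg ArithmeticFunction.vonMangoldt_nonneg (Nat.cast_nonneg _)
  refine ⟨∑' n : ℕ, if ¬ n.Prime then ArithmeticFunction.vonMangoldt n / (n : ℝ) else 0,
    tsum_nonneg hnn, fun s => ?_⟩
  rw [Finset.sum_filter]
  exact h.sum_le_tsum s fun n _ => hnn n

open Classical in
/-- A Chebyshev type lower bound for the primes with a degree one prime of `K` above them. -/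
theorem exists_le_sum_log_div_split_primes (K : Type*) [Field K] [NumberField K] :
    ∃ A : ℝ, 2 ≤ A ∧ ∃ c : ℝ, 0 < c ∧ ∃ x₁ : ℝ, ∀ x : ℝ, x₁ ≤ x →
      c ≤ ∑ p ∈ Finset.Ioc ⌊x / A⌋₊ ⌊x⌋₊ with p.Prime ∧ Nonempty (𝓞 K →+* ZMod p),
        Real.log p / p := by
  obtain ⟨B, c₀, hB⟩ := exists_sum_normVonMangoldt_bounds K
  obtain ⟨C, hC0, hC⟩ := exists_sum_not_prime_vonMangoldt_le
  set m := Module.finrank ℚ K with hm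
  have hm0 : 0 < m := Module.finrank_pos
  have hmr : (1 : ℝ) ≤ m := by exact_mod_cast hm0
  have hlog2 : 0 < Real.log 2 := Real.log_pos one_lt_two
  obtain ⟨l, hl⟩ := exists_nat_ge ((1 + m * C + 2 * B) / (m * Real.log 2) + c₀)
  have hl' : 1 + m * C + 2 * B ≤ m * (l - c₀) * Real.log 2 := by
    have : (1 + m * C + 2 * B) / (m * Real.log 2) ≤ l - c₀ := by linarith
    rw [div_le_iff₀ (by positivity)] at this
    linarith
  have hblock : ∀ h : ℕ, c₀ ≤ h → 1 / m ≤
      ∑ p ∈ Finset.Ico (2 ^ (m * h)) (2 ^ (m * (h + l))) with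
        p.Prime ∧ Nonempty (𝓞 K →+* ZMod p), Real.log p / p := by
    intro h hh
    obtain ⟨h', rfl⟩ := Nat.exists_eq_add_of_le' hh
    have h1 := (hB (h' + c₀)).1
    have h2 := (hB (h' + l)).2
    have h3 : h' + l + c₀ = h' + c₀ + l := by ring
    rw [h3] at h2
    have hle : 2 ^ (m * (h' + c₀)) ≤ 2 ^ (m * (h' + c₀ + l)) :=
      Nat.pow_le_pow_right two_pos (Nat.mul_le_mul_left m (Nat.le_add_right _ _))
    rw [← Finset.sum_range_add_sum_Ico _ hle] at h2
    set S := Finset.Ico (2 ^ (m * (h' + c₀))) (2 ^ (m * (h' + c₀ + l)))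
    have h4 : ∑ n ∈ S, normVonMangoldt (𝓞 K) n / n ≤
        m * (∑ n ∈ S with ¬ n.Prime, ArithmeticFunction.vonMangoldt n / n) +
        m * ∑ p ∈ S with p.Prime ∧ Nonempty (𝓞 K →+* ZMod p), Real.log p / p := by
      rw [Finset.sum_filter, Finset.sum_filter, Finset.mul_sum, Finset.mul_sum,
        ← Finset.sum_add_distrib]
      refine Finset.sum_le_sum fun n _ => ?_
      have h5 := normVonMangoldt_le (𝓞 K) n
      rw [RingOfIntegers.rank] at h5
      have hn : (0 : ℝ) ≤ n := Nat.cast_nonneg n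
      by_cases hp : n.Prime
      · by_cases h0 : normVonMangoldt (𝓞 K) n = 0
        · rw [h0, zero_div]
          refine add_nonneg (mul_nonneg (by positivity) ?_) (mul_nonneg (by positivity) ?_)
          · rw [if_neg (not_not.2 hp)]
          · split_ifs
            · exact div_nonneg (Real.log_natCast_nonneg _) hn
            · exact le_rfl
        · have h6 := exists_hom_zmod_of_normVonMangoldt_ne_zero (𝓞 K) hp h0
          rw [ArithmeticFunction.vonMangoldt_apply_prime hp] at h5
          simp only [hp, not_true, if_false, h6, and_self, if_true, mul_zero, zero_add]
          rw [← mul_div_assoc]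
          gcongr
      · simp only [hp, not_false_eq_true, if_true, false_and, if_false, mul_zero, add_zero]
        rw [← mul_div_assoc]
        gcongr
    have h5 := mul_le_mul_of_nonneg_left (hC S) (zero_le_one.trans hmr)
    rw [div_le_iff₀ (by positivity), mul_comm]
    push_cast at h1 h2
    have h6 : (m : ℝ) * (h' + l) * Real.log 2 =
        m * (h' + c₀) * Real.log 2 + m * (l - c₀) * Real.log 2 := by
      ring
    linarith
  refine ⟨2 ^ (m * (l + 1)), ?_, 1 / m, by positivity, 2 ^ (m * (l + c₀)), fun x hx => ?_⟩
  · exact le_self_pow₀ one_le_two (by positivity)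
  have hy : (1 : ℝ) < 2 ^ m := one_lt_pow₀ one_lt_two hm0.ne'
  have hx1 : 1 ≤ x := (one_le_pow₀ one_le_two).trans hx
  obtain ⟨k, hk1, hk2⟩ := exists_nat_pow_near hx1 hy
  rw [← pow_mul] at hk1 hk2
  have hk : l + c₀ ≤ k := by
    by_contra hlt
    have h1 : (2 : ℝ) ^ (m * (k + 1)) ≤ 2 ^ (m * (l + c₀)) :=
      pow_le_pow_right₀ one_le_two (Nat.mul_le_mul_left m (by omega))
    linarith
  obtain ⟨h, rfl⟩ := Nat.exists_eq_add_of_le' ((Nat.le_add_right l c₀).trans hk)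
  refine (hblock h (by omega)).trans ?_
  refine Finset.sum_le_sum_of_subset_of_nonneg (Finset.filter_subset_filter _ ?_)
    fun p _ _ => div_nonneg (Real.log_natCast_nonneg _) (Nat.cast_nonneg _)
  intro n hn
  rw [Finset.mem_Ico] at hn
  rw [Finset.mem_Ioc]
  constructor
  · rw [Nat.floor_lt (by positivity), div_lt_iff₀ (by positivity)]
    refine hk2.trans_le ?_
    have h1 : (2 : ℝ) ^ (m * h) ≤ n := by exact_mod_cast hn.1
    calc (2 : ℝ) ^ (m * (h + l + 1)) = 2 ^ (m * h) * 2 ^ (m * (l + 1)) := by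
          rw [← pow_add]
          ring_nf
      _ ≤ _ := by gcongr
  · refine Nat.le_floor ?_
    have h1 : (n : ℝ) ≤ 2 ^ (m * (h + l)) := by exact_mod_cast hn.2.le
    exact h1.trans hk1

end SplitPrimes

section ChoiceOfField

open NumberField

theorem exists_dvd_eval_of_hom_zmod {K : Type*} [Field K] {f : ℤ[X]} {α : K}
    [CharZero K] (hα : aeval α f = 0) {p : ℕ} [Fact p.Prime] (hp : ¬ (p : ℤ) ∣ f.leadingCoeff)
    (φ : 𝓞 K →+* ZMod p) : ∃ x : ℤ, (p : ℤ) ∣ f.eval x := by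
  set a := f.leadingCoeff with ha
  have hαi : IsIntegral ℤ (a • α) := isIntegral_leadingCoeff_smul f α hα
  set θ : 𝓞 K := ⟨a • α, hαi⟩ with hθ
  have h1 : eval₂ (algebraMap ℤ (𝓞 K)) θ (scaleRoots f a) = 0 := by
    apply RingOfIntegers.coe_injective
    rw [map_zero, Polynomial.hom_eval₂]
    have h2 : algebraMap (𝓞 K) K θ = algebraMap ℤ K a * α := by
      rw [← Algebra.smul_def]
      rfl
    rw [h2, ← IsScalarTower.algebraMap_eq, scaleRoots_eval₂_mul, ← aeval_def, hα, mul_zero]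
  have h2 := congrArg φ h1
  rw [map_zero, Polynomial.hom_eval₂, RingHom.ext_int (φ.comp (algebraMap ℤ (𝓞 K)))
    (Int.castRingHom (ZMod p))] at h2
  have ha0 : Int.castRingHom (ZMod p) a ≠ 0 := by
    rw [eq_intCast, Ne, ZMod.intCast_zmod_eq_zero_iff_dvd]
    exact hp
  have h3 : φ θ = Int.castRingHom (ZMod p) a * (φ θ / Int.castRingHom (ZMod p) a) := by
    field_simp
  rw [h3, scaleRoots_eval₂_mul] at h2
  have h4 := (mul_eq_zero.1 h2).resolve_left (pow_ne_zero _ ha0)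
  obtain ⟨x, hx⟩ := ZMod.intCast_surjective (φ θ / Int.castRingHom (ZMod p) a)
  refine ⟨x, ?_⟩
  rw [← hx, ← eq_intCast (Int.castRingHom (ZMod p)) x, Polynomial.eval₂_at_apply, eq_intCast,
    ZMod.intCast_zmod_eq_zero_iff_dvd] at h4
  exact h4

theorem dvd_sub_one_of_hom_zmod {K : Type*} [Field K] [CharZero K] {N : ℕ} [NeZero N] {ζ : K}
    (hζ : IsPrimitiveRoot ζ N) {p : ℕ} [Fact p.Prime] (hp : ¬ p ∣ N)
    (φ : 𝓞 K →+* ZMod p) : N ∣ p - 1 := by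
  have hpN : NeZero (N : ZMod p) := ⟨by rwa [Ne, ZMod.natCast_eq_zero_iff]⟩
  have hζ' : IsPrimitiveRoot hζ.toInteger N := hζ.toInteger_isPrimitiveRoot
  have h1 : (cyclotomic N (𝓞 K)).IsRoot hζ.toInteger := hζ'.isRoot_cyclotomic (NeZero.pos N)
  have h2 : (cyclotomic N (ZMod p)).IsRoot (φ hζ.toInteger) := by
    rw [← map_cyclotomic N φ]
    exact h1.map
  rw [isRoot_cyclotomic_iff] at h2
  have h3 := h2.eq_orderOf
  have h0 : φ hζ.toInteger ≠ 0 := h2.ne_zero (NeZero.ne N)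
  rw [h3]
  exact orderOf_dvd_of_pow_eq_one (ZMod.pow_card_sub_one_eq_one h0)

theorem exists_numberField_of_split_primes {f : ℤ[X]} (hf : 0 < f.natDegree) {N : ℕ} (hN : 0 < N) :
    ∃ (K : Type) (_ : Field K) (_ : NumberField K), ∀ p : ℕ, p.Prime → ¬ p ∣ N →
      ¬ (p : ℤ) ∣ f.leadingCoeff → Nonempty (𝓞 K →+* ZMod p) →
        N ∣ p - 1 ∧ ∃ x : ℤ, (p : ℤ) ∣ f.eval x := by
  have hN' : NeZero N := ⟨hN.ne'⟩
  set g : ℚ[X] := f.map (Int.castRingHom ℚ) * cyclotomic N ℚ with hg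
  have hf0 : f.map (Int.castRingHom ℚ) ≠ 0 := by
    rw [Ne, Polynomial.map_eq_zero_iff (RingHom.injective_int _)]
    rintro rfl
    simp at hf
  have hg0 : g ≠ 0 := mul_ne_zero hf0 (cyclotomic_ne_zero N ℚ)
  have hsp := SplittingField.splits g
  rw [hg, Polynomial.map_mul] at hsp
  have hz : CharZero g.SplittingField := charZero_of_injective_algebraMap
    (algebraMap ℚ g.SplittingField).injective
  have hnf : NumberField g.SplittingField := ⟨⟩
  obtain ⟨hs1, hs2⟩ := (splits_mul (Polynomial.map_ne_zero hf0)
    (Polynomial.map_ne_zero (cyclotomic_ne_zero N ℚ))).1 hsp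
  obtain ⟨α, hα⟩ := hs1.exists_eval_eq_zero (by
    rw [degree_map, degree_map_eq_of_injective (RingHom.injective_int _)]
    exact (natDegree_pos_iff_degree_pos.1 hf).ne')
  obtain ⟨ζ, hζ⟩ := hs2.exists_eval_eq_zero (by
    rw [degree_map, degree_cyclotomic]
    exact_mod_cast (Nat.totient_pos.2 hN).ne')
  have hα' : aeval α f = 0 := by
    rw [eval_map, eval₂_map] at hα
    rw [aeval_def, ← hα]
    congr 1
  have hζ' : IsPrimitiveRoot ζ N := by
    rw [map_cyclotomic] at hζ
    have : NeZero (N : g.SplittingField) := ⟨Nat.cast_ne_zero.2 hN.ne'⟩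
    exact isRoot_cyclotomic_iff.1 hζ
  refine ⟨g.SplittingField, inferInstance, hnf, fun p hp hpN hpf ⟨φ⟩ => ?_⟩
  have : Fact p.Prime := ⟨hp⟩
  exact ⟨dvd_sub_one_of_hom_zmod hζ' hpN φ, exists_dvd_eval_of_hom_zmod hα' hpf φ⟩

open Classical in
theorem exists_le_sum_log_div_primes_root {f : ℤ[X]} (hf : 0 < f.natDegree) {N : ℕ} (hN : 0 < N) :
    ∃ A : ℝ, 2 ≤ A ∧ ∃ c : ℝ, 0 < c ∧ ∃ x₁ : ℝ, ∀ x : ℝ, x₁ ≤ x →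
      c ≤ ∑ p ∈ Finset.Ioc ⌊x / A⌋₊ ⌊x⌋₊ with
        p.Prime ∧ N ∣ p - 1 ∧ ∃ x : ℤ, (p : ℤ) ∣ f.eval x, Real.log p / p := by
  obtain ⟨K, _, _, hK⟩ := exists_numberField_of_split_primes hf hN
  obtain ⟨A, hA, c, hc, x₁, hx₁⟩ := exists_le_sum_log_div_split_primes K
  have hf0 : f.leadingCoeff.natAbs ≠ 0 := by
    rw [Ne, Int.natAbs_eq_zero, leadingCoeff_eq_zero]
    rintro rfl
    simp at hf
  set M := max N f.leadingCoeff.natAbs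
  refine ⟨A, hA, c, hc, max x₁ (A * M), fun x hx => ?_⟩
  refine (hx₁ x ((le_max_left _ _).trans hx)).trans
    (Finset.sum_le_sum_of_subset_of_nonneg (fun p hp => ?_)
      fun p _ _ => div_nonneg (Real.log_natCast_nonneg _) (Nat.cast_nonneg _))
  rw [Finset.mem_filter] at hp ⊢
  obtain ⟨hpx, hpp, hφ⟩ := hp
  have hMp : M < p := by
    have h1 : A * M ≤ x := (le_max_right _ _).trans hx
    have h2 : M ≤ ⌊x / A⌋₊ := by
      refine Nat.le_floor ?_
      rw [le_div_iff₀ (by linarith)]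
      linarith
    exact h2.trans_lt (Finset.mem_Ioc.1 hpx).1
  refine ⟨hpx, hpp, hK p hpp (fun h => ?_) (fun h => ?_) hφ⟩
  · have := Nat.le_of_dvd hN h
    have := le_max_left N f.leadingCoeff.natAbs
    omega
  · have := Nat.le_of_dvd (Nat.pos_of_ne_zero hf0) (Int.natCast_dvd.1 h)
    have := le_max_right N f.leadingCoeff.natAbs
    omega

end ChoiceOfField

section SquarefreeCount

open Classical in
theorem exists_le_sum_inv_of_le_sum_log_div {P : ℕ → Prop} {A c x₁ : ℝ}
    (hA : 2 ≤ A) (hc : 0 < c) (h : ∀ x : ℝ, x₁ ≤ x →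
      c ≤ ∑ p ∈ Finset.Ioc ⌊x / A⌋₊ ⌊x⌋₊ with P p, Real.log p / p) :
    ∃ t : ℝ, 0 < t ∧ t ≤ 1 ∧ ∃ j₀ : ℕ, x₁ ≤ A ^ 2 ^ j₀ ∧ ∀ j, j₀ ≤ j →
      t ≤ ∑ p ∈ Finset.Ioc ⌊A ^ 2 ^ j⌋₊ ⌊A ^ 2 ^ (j + 1)⌋₊ with P p, (1 : ℝ) / p := by
  have hL : 0 < Real.log A := Real.log_pos (by linarith)
  have hA1 : 1 ≤ A := by linarith
  have hmono : ∀ i k : ℕ, i ≤ k → ⌊A ^ i⌋₊ ≤ ⌊A ^ k⌋₊ := fun i k hik =>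
    Nat.floor_le_floor (pow_le_pow_right₀ hA1 hik)
  obtain ⟨j₀, hj₀⟩ : ∃ j₀ : ℕ, x₁ ≤ A ^ 2 ^ j₀ := by
    obtain ⟨k, hk⟩ := pow_unbounded_of_one_lt x₁ (show 1 < A by linarith)
    exact ⟨k, hk.le.trans (pow_le_pow_right₀ hA1 Nat.lt_two_pow_self.le)⟩
  have hstep : ∀ M i k : ℕ, 2 ^ j₀ ≤ i → i + k ≤ M → k * (c / (M * Real.log A)) ≤
      ∑ p ∈ Finset.Ioc ⌊A ^ i⌋₊ ⌊A ^ (i + k)⌋₊ with P p, (1 : ℝ) / p := by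
    intro M i k hi
    induction k with
    | zero => intro; simp
    | succ k ih =>
      intro hM
      have h1 := ih (by omega)
      have h2 : Finset.Ioc ⌊A ^ i⌋₊ ⌊A ^ (i + (k + 1))⌋₊ =
          (Finset.Ioc ⌊A ^ i⌋₊ ⌊A ^ (i + k)⌋₊).disjUnion
            (Finset.Ioc ⌊A ^ (i + k)⌋₊ ⌊A ^ (i + (k + 1))⌋₊)
            (Finset.Ioc_disjoint_Ioc_of_le le_rfl) := by
        rw [Finset.disjUnion_eq_union,
          Finset.Ioc_union_Ioc_eq_Ioc (hmono _ _ (by omega)) (hmono _ _ (by omega))]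
      have hMpos : (0 : ℝ) < M := by
        have : 0 < M := by omega
        exact_mod_cast this
      have h3 : c / (M * Real.log A) ≤
          ∑ p ∈ Finset.Ioc ⌊A ^ (i + k)⌋₊ ⌊A ^ (i + (k + 1))⌋₊ with P p, (1 : ℝ) / p := by
        have h4 := h (A ^ (i + (k + 1))) (hj₀.trans (pow_le_pow_right₀ hA1 (by omega)))
        have h5 : A ^ (i + (k + 1)) / A = A ^ (i + k) := by
          rw [← add_assoc, pow_succ]
          field_simp
        rw [h5] at h4
        rw [div_le_iff₀ (by positivity), Finset.sum_mul]
        refine h4.trans (Finset.sum_le_sum fun p hp => ?_)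
        rw [Finset.mem_filter, Finset.mem_Ioc] at hp
        have hp0 : (0 : ℝ) < p := by
          have : 0 < p := by omega
          exact_mod_cast this
        rw [div_mul_eq_mul_div, one_mul]
        gcongr
        calc Real.log p ≤ Real.log (A ^ (i + (k + 1))) := by
              gcongr
              exact (Nat.le_floor_iff (by positivity)).1 hp.1.2
          _ = (i + (k + 1) : ℕ) * Real.log A := by rw [Real.log_pow]
          _ ≤ _ := by gcongr
      rw [h2, Finset.filter_disjUnion, Finset.sum_disjUnion]
      push_cast
      linarith
  refine ⟨min 1 (c / (2 * Real.log A)), by positivity, min_le_left _ _, j₀, hj₀, fun j hj => ?_⟩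
  have h1 := hstep (2 ^ (j + 1)) (2 ^ j) (2 ^ j) (Nat.pow_le_pow_right two_pos hj)
    (by rw [pow_succ]; omega)
  rw [← two_mul, ← pow_succ'] at h1
  refine (min_le_right _ _).trans (le_trans (le_of_eq ?_) h1)
  push_cast
  rw [pow_succ]
  field_simp

theorem eq_and_eq_of_mul_prime_eq {y e e' p p' : ℕ} (he' : ∀ q : ℕ, q.Prime → q ∣ e' → q ≤ y)
    (hp : p.Prime) (hp' : p'.Prime) (hyp : y < p)
    (h : e * p = e' * p') : e = e' ∧ p = p' := by
  have h1 : p ∣ e' * p' := h ▸ Dvd.intro_left e rfl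
  rcases hp.dvd_mul.1 h1 with h2 | h2
  · exact absurd (he' p hp h2) (not_le.2 hyp)
  · have h3 := (Nat.prime_dvd_prime_iff_eq hp hp').1 h2
    subst h3
    exact ⟨Nat.eq_of_mul_eq_mul_right hp.pos h, rfl⟩

theorem squarefree_mul_prime {y e p : ℕ} (hs : Squarefree e)
    (he : ∀ q : ℕ, q.Prime → q ∣ e → q ≤ y) (hp : p.Prime) (hyp : y < p) :
    Squarefree (e * p) := by
  refine (Nat.squarefree_mul ?_).2 ⟨hs, hp.squarefree⟩
  exact ((Nat.Prime.coprime_iff_not_dvd hp).2 fun h => absurd (he p hp h) (not_le.2 hyp)).symm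

open Classical in
theorem exists_finset_sum_inv_ge {P : ℕ → Prop} (hP : ∀ p, P p → p.Prime) {A t : ℝ} (hA : 2 ≤ A)
    (ht : 0 < t) {j₀ : ℕ}
    (h : ∀ j, j₀ ≤ j →
      t ≤ ∑ p ∈ Finset.Ioc ⌊A ^ 2 ^ j⌋₊ ⌊A ^ 2 ^ (j + 1)⌋₊ with P p, (1 : ℝ) / p) (k : ℕ) :
    ∃ E : Finset ℕ, (∀ e ∈ E, Squarefree e ∧ (∀ p : ℕ, p.Prime → p ∣ e → P p) ∧
      (∀ p : ℕ, p.Prime → p ∣ e → p ≤ ⌊A ^ 2 ^ (j₀ + k)⌋₊) ∧ (e : ℝ) ≤ A ^ 2 ^ (j₀ + k + 1)) ∧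
      (1 + t) ^ k ≤ ∑ e ∈ E, (1 : ℝ) / e := by
  have hA1 : 1 ≤ A := by linarith
  induction k with
  | zero =>
    refine ⟨{1}, ?_, by simp⟩
    intro e he
    rw [Finset.mem_singleton] at he
    subst he
    refine ⟨squarefree_one, fun p hp h1 => ?_, fun p hp h1 => ?_, ?_⟩
    · exact absurd (Nat.dvd_one.1 h1) hp.ne_one
    · exact absurd (Nat.dvd_one.1 h1) hp.ne_one
    · exact_mod_cast one_le_pow₀ hA1
  | succ k ih =>
    obtain ⟨E, hE, hsum⟩ := ih
    set j := j₀ + k with hj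
    set B := (Finset.Ioc ⌊A ^ 2 ^ j⌋₊ ⌊A ^ 2 ^ (j + 1)⌋₊).filter P with hB
    have hBmem : ∀ p ∈ B, P p ∧ p.Prime ∧ ⌊A ^ 2 ^ j⌋₊ < p ∧ p ≤ ⌊A ^ 2 ^ (j + 1)⌋₊ := by
      intro p hp
      rw [hB, Finset.mem_filter, Finset.mem_Ioc] at hp
      exact ⟨hp.2, hP p hp.2, hp.1⟩
    have hfl : ⌊A ^ 2 ^ j⌋₊ ≤ ⌊A ^ 2 ^ (j + 1)⌋₊ := Nat.floor_le_floor
      (pow_le_pow_right₀ hA1 (Nat.pow_le_pow_right two_pos (Nat.le_succ j)))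
    set F := (E ×ˢ B).image (fun q => q.1 * q.2) with hF
    have hdisj : Disjoint E F := by
      rw [Finset.disjoint_left]
      intro e he heF
      obtain ⟨⟨e', p⟩, hq, rfl⟩ := Finset.mem_image.1 heF
      rw [Finset.mem_product] at hq
      have hp := hBmem p hq.2
      have := (hE _ he).2.2.1 p hp.2.1 (Dvd.intro_left _ rfl)
      omega
    have hinj : Set.InjOn (fun q : ℕ × ℕ => q.1 * q.2) (E ×ˢ B : Finset (ℕ × ℕ)) := by
      rintro ⟨e, p⟩ hq ⟨e', p'⟩ hq' heq
      rw [Finset.mem_coe, Finset.mem_product] at hq hq'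
      have hp := hBmem p hq.2
      have hp' := hBmem p' hq'.2
      have := eq_and_eq_of_mul_prime_eq (e := e) (hE e' hq'.1).2.2.1 hp.2.1 hp'.2.1
        hp.2.2.1 heq
      exact Prod.ext this.1 this.2
    refine ⟨E ∪ F, fun e he => ?_, ?_⟩
    · rcases Finset.mem_union.1 he with he | he
      · obtain ⟨h1, h2, h3, h4⟩ := hE e he
        exact ⟨h1, h2, fun p hp hpe => (h3 p hp hpe).trans hfl,
          h4.trans (pow_le_pow_right₀ hA1 (Nat.pow_le_pow_right two_pos (by omega)))⟩
      · obtain ⟨⟨e', p⟩, hq, rfl⟩ := Finset.mem_image.1 he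
        rw [Finset.mem_product] at hq
        obtain ⟨h1, h2, h3, h4⟩ := hE e' hq.1
        obtain ⟨hp1, hp2, hp3, hp4⟩ := hBmem p hq.2
        refine ⟨squarefree_mul_prime h1 h3 hp2 hp3, fun q hqp hdvd => ?_, fun q hqp hdvd => ?_, ?_⟩
        · rcases hqp.dvd_mul.1 hdvd with hd | hd
          · exact h2 q hqp hd
          · rwa [(Nat.prime_dvd_prime_iff_eq hqp hp2).1 hd]
        · rcases hqp.dvd_mul.1 hdvd with hd | hd
          · exact (h3 q hqp hd).trans hfl
          · rwa [(Nat.prime_dvd_prime_iff_eq hqp hp2).1 hd]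
        · have h5 : (p : ℝ) ≤ A ^ 2 ^ (j + 1) := (Nat.le_floor_iff (by positivity)).1 hp4
          calc ((e' * p : ℕ) : ℝ) = e' * p := by push_cast; rfl
            _ ≤ A ^ 2 ^ (j + 1) * A ^ 2 ^ (j + 1) := by gcongr
            _ = A ^ 2 ^ (j + 1 + 1) := by
              rw [← pow_add, ← two_mul, ← pow_succ']
    · rw [Finset.sum_union hdisj, hF, Finset.sum_image hinj, Finset.sum_product]
      have h1 : ∑ e ∈ E, ∑ p ∈ B, (1 : ℝ) / ((e * p : ℕ) : ℝ) =
          (∑ e ∈ E, (1 : ℝ) / e) * ∑ p ∈ B, (1 : ℝ) / p := by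
        rw [Finset.sum_mul_sum]
        refine Finset.sum_congr rfl fun e _ => Finset.sum_congr rfl fun p _ => ?_
        push_cast
        rw [div_mul_div_comm, one_mul]
      simp only [h1]
      have h2 := h j (by omega)
      have h3 : (0 : ℝ) ≤ ∑ e ∈ E, (1 : ℝ) / e := by positivity
      calc (1 + t) ^ (k + 1) = (1 + t) ^ k * (1 + t) := pow_succ _ _
        _ ≤ (∑ e ∈ E, (1 : ℝ) / e) * (1 + ∑ p ∈ B, (1 : ℝ) / p) := by gcongr
        _ = _ := by ring

open Classical in
theorem exists_finset_squarefree_card_ge {P : ℕ → Prop} (hP : ∀ p, P p → p.Prime) {A c x₁ : ℝ}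
    (hA : 2 ≤ A) (hc : 0 < c) (h : ∀ x : ℝ, x₁ ≤ x →
      c ≤ ∑ p ∈ Finset.Ioc ⌊x / A⌋₊ ⌊x⌋₊ with P p, Real.log p / p) :
    ∃ γ : ℝ, 0 ≤ γ ∧ γ < 1 ∧ ∃ c' : ℝ, 0 < c' ∧ ∃ X₀ : ℝ, ∀ X : ℝ, X₀ ≤ X →
      ∃ E : Finset ℕ, (∀ e ∈ E, Squarefree e ∧ (∀ p : ℕ, p.Prime → p ∣ e → P p) ∧ (e : ℝ) ≤ X) ∧
        c' * X / (Real.log X) ^ γ ≤ E.card := by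
  obtain ⟨t, ht, ht1, j₀, hj₀, hB⟩ := exists_le_sum_inv_of_le_sum_log_div hA hc h
  have hL : 0 < Real.log A := Real.log_pos (by linarith)
  have hA1 : 1 ≤ A := by linarith
  set L := Real.log A with hLdef
  set δ := Real.logb 2 (1 + t) with hδ
  have hδ0 : 0 < δ := Real.logb_pos one_lt_two (by linarith)
  have hδ1 : δ ≤ 1 := by
    rw [hδ, Real.logb_le_iff_le_rpow one_lt_two (by linarith), Real.rpow_one]
    linarith
  have h2δ : (2 : ℝ) ^ δ = 1 + t :=
    Real.rpow_logb two_pos (by norm_num) (by linarith)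
  refine ⟨1 - δ, by linarith, by linarith,
    c / A * (1 / ((12 * L) ^ δ * (1 + t) ^ j₀)), by positivity,
    Real.exp (6 * L * 2 ^ (j₀ + 1)), fun X hX => ?_⟩
  have hX0 : 0 < X := (Real.exp_pos _).trans_le hX
  have hlogX : 6 * L * 2 ^ (j₀ + 1) ≤ Real.log X := (Real.le_log_iff_exp_le hX0).2 hX
  have h6L : 0 < 6 * L := by positivity
  have hratio : (2 : ℝ) ^ (j₀ + 1) ≤ Real.log X / (6 * L) := by
    rw [le_div_iff₀ h6L]
    linarith
  have hlog0 : 0 < Real.log X := lt_of_lt_of_le (by positivity) hlogX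
  obtain ⟨J, hJ1, hJ2⟩ := exists_nat_pow_near ((one_le_pow₀ one_le_two).trans hratio)
    (one_lt_two (α := ℝ))
  have hJj : j₀ ≤ J := by
    by_contra hlt
    have h1 : (2 : ℝ) ^ (J + 1) ≤ 2 ^ (j₀ + 1) := pow_le_pow_right₀ one_le_two (by omega)
    linarith
  rw [le_div_iff₀ h6L] at hJ1
  rw [div_lt_iff₀ h6L] at hJ2
  obtain ⟨k, rfl⟩ := Nat.exists_eq_add_of_le hJj
  obtain ⟨E, hE, hsum⟩ := exists_finset_sum_inv_ge hP hA ht hB k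
  set Z := A ^ 2 ^ (j₀ + k + 1) with hZ
  have hZ1 : 1 ≤ Z := one_le_pow₀ hA1
  have hAZ : A ≤ Z := le_self_pow₀ hA1 (by positivity)
  have hZX : Z ^ 3 ≤ X := by
    rw [← Real.log_le_log_iff (by positivity) hX0, Real.log_pow, hZ, Real.log_pow]
    push_cast
    rw [pow_succ]
    linarith
  have hyZ : A ^ 2 ^ (j₀ + k) ≤ Z :=
    pow_le_pow_right₀ hA1 (Nat.pow_le_pow_right two_pos (Nat.le_succ _))
  have hxZ : x₁ ≤ Z := hj₀.trans
    (pow_le_pow_right₀ hA1 (Nat.pow_le_pow_right two_pos (by omega)))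
  set B : ℕ → Finset ℕ := fun e => (Finset.Ioc ⌊X / e / A⌋₊ ⌊X / e⌋₊).filter P with hBdef
  have he1 : ∀ e ∈ E, (1 : ℝ) ≤ e := fun e he => by
    exact_mod_cast Nat.one_le_iff_ne_zero.2 (hE e he).1.ne_zero
  have hXe : ∀ e ∈ E, Z ^ 2 ≤ X / e := by
    intro e he
    rw [le_div_iff₀ (by linarith [he1 e he])]
    calc Z ^ 2 * e ≤ Z ^ 2 * Z := by
          gcongr
          exact (hE e he).2.2.2
      _ = Z ^ 3 := by ring
      _ ≤ X := hZX
  have hZZ : Z ≤ Z ^ 2 := le_self_pow₀ hZ1 two_ne_zero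
  have hBmem : ∀ e ∈ E, ∀ p ∈ B e, P p ∧ p.Prime ∧ ⌊A ^ 2 ^ (j₀ + k)⌋₊ < p ∧
      X / e / A < p ∧ (p : ℝ) ≤ X / e := by
    intro e he p hp
    simp only [hBdef, Finset.mem_filter, Finset.mem_Ioc] at hp
    have h1 := hXe e he
    have hnn : 0 ≤ X / e := by positivity
    refine ⟨hp.2, hP p hp.2, lt_of_le_of_lt (Nat.floor_le_floor ?_) hp.1.1,
      (Nat.floor_lt (by positivity)).1 hp.1.1, (Nat.le_floor_iff hnn).1 hp.1.2⟩
    rw [le_div_iff₀ (by linarith)]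
    calc A ^ 2 ^ (j₀ + k) * A ≤ Z * Z := by gcongr
      _ = Z ^ 2 := by ring
      _ ≤ _ := h1
  refine ⟨(E.sigma B).image (fun q => q.1 * q.2), fun e he => ?_, ?_⟩
  · obtain ⟨⟨e', p⟩, hq, rfl⟩ := Finset.mem_image.1 he
    rw [Finset.mem_sigma] at hq
    obtain ⟨h1, h2, h3, h4⟩ := hE e' hq.1
    obtain ⟨hp1, hp2, hp3, hp4, hp5⟩ := hBmem e' hq.1 p hq.2
    refine ⟨squarefree_mul_prime h1 h3 hp2 hp3, fun q hqp hdvd => ?_, ?_⟩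
    · rcases hqp.dvd_mul.1 hdvd with hd | hd
      · exact h2 q hqp hd
      · rwa [(Nat.prime_dvd_prime_iff_eq hqp hp2).1 hd]
    · rw [le_div_iff₀ (by linarith [he1 e' hq.1])] at hp5
      push_cast
      linarith
  · rw [Finset.card_image_of_injOn, Finset.card_sigma]
    · have hcount : ∀ e ∈ E, c / A * X / Real.log X * (1 / e) ≤ ((B e).card : ℝ) := by
        intro e he
        have hepos : (0 : ℝ) < e := by linarith [he1 e he]
        have h1 := h (X / e) ((hxZ.trans hZZ).trans (hXe e he))
        have h2 : c ≤ (B e).card • (Real.log X / (X / e / A)) := by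
          refine h1.trans (Finset.sum_le_card_nsmul _ _ _ fun p hp => ?_)
          obtain ⟨hp1, hp2, hp3, hp4, hp5⟩ := hBmem e he p hp
          have hp0 : (0 : ℝ) < p := by exact_mod_cast hp2.pos
          have hpX : (p : ℝ) ≤ X := hp5.trans (div_le_self hX0.le (he1 e he))
          gcongr
        rw [nsmul_eq_mul] at h2
        calc c / A * X / Real.log X * (1 / e) = c / (Real.log X / (X / e / A)) := by
              field_simp
          _ ≤ _ := by
              rw [div_le_iff₀ (by positivity)]
              exact h2
      have hpow : (Real.log X) ^ δ ≤ (12 * L) ^ δ * (1 + t) ^ (j₀ + k) := by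
        have h1 : Real.log X ≤ (12 * L) * 2 ^ (j₀ + k) := by
          rw [pow_succ] at hJ2
          linarith
        calc (Real.log X) ^ δ ≤ ((12 * L) * 2 ^ (j₀ + k)) ^ δ :=
              Real.rpow_le_rpow hlog0.le h1 hδ0.le
          _ = _ := by
              rw [Real.mul_rpow (by positivity) (by positivity), ← h2δ, ← Real.rpow_natCast,
                ← Real.rpow_natCast, ← Real.rpow_mul two_pos.le, ← Real.rpow_mul two_pos.le,
                mul_comm δ]
      have hlogδ : 0 < (Real.log X) ^ (1 - δ) := Real.rpow_pos_of_pos hlog0 _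
      push_cast
      calc c / A * (1 / ((12 * L) ^ δ * (1 + t) ^ j₀)) * X / (Real.log X) ^ (1 - δ) =
            c / A * X / Real.log X * ((Real.log X) ^ δ / ((12 * L) ^ δ * (1 + t) ^ j₀)) := by
            rw [Real.rpow_sub hlog0, Real.rpow_one]
            field_simp
        _ ≤ c / A * X / Real.log X * (1 + t) ^ k := by
            gcongr
            rw [div_le_iff₀ (by positivity)]
            refine hpow.trans (le_of_eq ?_)
            rw [pow_add]
            ring
        _ ≤ c / A * X / Real.log X * ∑ e ∈ E, (1 : ℝ) / e := by gcongr
        _ = ∑ e ∈ E, c / A * X / Real.log X * (1 / e) := Finset.mul_sum _ _ _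
        _ ≤ _ := Finset.sum_le_sum hcount
    · rintro ⟨e, p⟩ hq ⟨e', p'⟩ hq' heq
      rw [Finset.mem_coe, Finset.mem_sigma] at hq hq'
      have hp := hBmem e hq.1 p hq.2
      have hp' := hBmem e' hq'.1 p' hq'.2
      obtain ⟨rfl, rfl⟩ := eq_and_eq_of_mul_prime_eq (hE e' hq'.1).2.2.1 hp.2.1 hp'.2.1
        hp.2.2.1 heq
      rfl

end SquarefreeCount

theorem dvd_sub_one_of_prime_factors {N e : ℕ} (he : e ≠ 0)
    (h : ∀ p, p.Prime → p ∣ e → N ∣ p - 1) : (N : ℤ) ∣ (e : ℤ) - 1 := by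
  induction e using Nat.recOnMul with
  | zero => exact absurd rfl he
  | one => simp
  | prime p hp =>
    rw [← Nat.cast_one, ← Nat.cast_sub hp.one_le]
    exact Int.natCast_dvd_natCast.2 (h p hp dvd_rfl)
  | mul a b ha hb =>
    have h1 := ha (left_ne_zero_of_mul he) fun p hp hd => h p hp (hd.mul_right b)
    have h2 := hb (right_ne_zero_of_mul he) fun p hp hd => h p hp (hd.mul_left a)
    have h3 : ((a * b : ℕ) : ℤ) - 1 = (a - 1) * b + (b - 1) := by push_cast; ring
    rw [h3]
    exact dvd_add (h1.mul_right _) h2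

theorem finite_setOf_abs_intCast_le (X : ℝ) : {d : ℤ | |(d : ℝ)| ≤ X}.Finite := by
  refine (Set.finite_Icc (-⌊X⌋) ⌊X⌋).subset fun d hd => ?_
  obtain ⟨h1, h2⟩ := abs_le.1 (Set.mem_ofPred.1 hd)
  refine ⟨?_, Int.le_floor.2 h2⟩
  rw [neg_le]
  refine Int.le_floor.2 ?_
  push_cast
  linarith

/-- Unconditionally on local solubility of `y^n = f(x)` itself, `≫ X/(log X)^γ`
of the twists `d·y^n = f(x)` with `d` `n`-th power free, `|d| ≤ X`, are
everywhere locally soluble. -/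
theorem stmt_6 (n : ℕ) (hn : 2 ≤ n) (f : Polynomial ℤ)
    (hsf : Squarefree (f.map (Int.castRingHom ℚ))) (hdeg : 3 ≤ f.natDegree) :
    ∃ γ : ℝ, 0 ≤ γ ∧ γ < 1 ∧ ∃ c : ℝ, 0 < c ∧ ∃ X₀ : ℝ, ∀ X : ℝ, X₀ ≤ X →
      c * X / (Real.log X) ^ γ ≤
        ({d : ℤ | |(d : ℝ)| ≤ X ∧ NthPowerFree n d ∧
            EverywhereLocallySoluble n f d}.ncard : ℝ) := by
  have hdeg' : 0 < f.natDegree := by omega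
  obtain ⟨N, hN, d₀, hd₀, hsol⟩ :=
    exists_modulus_everywhereLocallySoluble n hn f hsf hdeg'
  obtain ⟨A, hA, c, hc, x₁, hsum⟩ := exists_le_sum_log_div_primes_root hdeg' hN
  obtain ⟨γ, hγ0, hγ1, c', hc', X₀, hcard⟩ := exists_finset_squarefree_card_ge
    (P := fun p => p.Prime ∧ N ∣ p - 1 ∧ ∃ x : ℤ, (p : ℤ) ∣ f.eval x)
    (fun p hp => hp.1) hA hc (x₁ := x₁) fun x hx => by convert hsum x hx
  have hD : (1 : ℝ) ≤ |(d₀ : ℝ)| := by exact_mod_cast Int.one_le_abs hd₀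
  have hD0 : (0 : ℝ) < |(d₀ : ℝ)| := by linarith
  refine ⟨γ, hγ0, hγ1, c' / |(d₀ : ℝ)|, by positivity, |(d₀ : ℝ)| * max X₀ 3, fun X hX => ?_⟩
  have hX' : max X₀ 3 ≤ X / |(d₀ : ℝ)| := by rwa [le_div_iff₀ hD0, mul_comm]
  have h3 : 3 ≤ X / |(d₀ : ℝ)| := (le_max_right _ _).trans hX'
  have hX0 : 0 < X := by
    have := (le_div_iff₀ hD0).1 h3
    nlinarith
  have hle : X / |(d₀ : ℝ)| ≤ X := div_le_self hX0.le hD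
  obtain ⟨E, hE, hEcard⟩ := hcard _ ((le_max_left _ _).trans hX')
  have hlog : 0 < Real.log (X / |(d₀ : ℝ)|) := Real.log_pos (by linarith)
  have hinj : Function.Injective fun e : ℕ => d₀ * (e : ℤ) := fun a b hab => by
    exact_mod_cast mul_left_cancel₀ hd₀ hab
  calc c' / |(d₀ : ℝ)| * X / Real.log X ^ γ
      = c' * (X / |(d₀ : ℝ)|) / Real.log X ^ γ := by ring
    _ ≤ c' * (X / |(d₀ : ℝ)|) / Real.log (X / |(d₀ : ℝ)|) ^ γ := by
        gcongr
    _ ≤ E.card := hEcard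
    _ = ((E.map ⟨_, hinj⟩ : Finset ℤ) : Set ℤ).ncard := by
        rw [Set.ncard_coe_finset, Finset.card_map]
    _ ≤ _ := by
        refine Nat.cast_le.2 (Set.ncard_le_ncard ?_
          ((finite_setOf_abs_intCast_le X).subset fun d hd => hd.1))
        intro d hd
        obtain ⟨e, he, rfl⟩ := Finset.mem_map.1 (Finset.mem_coe.1 hd)
        obtain ⟨hsq, hp, heX⟩ := hE e he
        refine ⟨?_, hsol e hsq (dvd_sub_one_of_prime_factors hsq.ne_zero
          fun p hpp hpe => (hp p hpp hpe).2.1) fun p hpp hpe => (hp p hpp hpe).2.2⟩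
        simp only [Function.Embedding.coeFn_mk]
        push_cast
        rw [abs_mul, Nat.abs_cast, mul_comm]
        exact (le_div_iff₀ hD0).1 heX
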